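/- arXiv:0812.2366 — 4 statements merged into one kernel-verified Lean document; each statement's English description precedes it below -/
import Mathlib

section
/- Let C_n^{d,alpha} be a hypercycle of length n, and for positive integers s_1,...,s_r define F(s_1,...,s_r,n) to be the set of subhypergraphs of C_n^{d,alpha} with no isolated vertex that are disjoint unions of r line hypergraphs of lengths s_1,...,s_r. If s_1 ≤ ... ≤ s_r with s_1 + ... + s_r = i, and the multiset {s_1,...,s_r} consists of t distinct values with multiplicities l_1,...,l_t, then |F(s_1,...,s_r,n)| = (n*(r-1)!/(l_1! ... l_t!)) * C(n - i - 1, r - 1). -/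
/-- The binomial coefficient `C(a, b)` for integer arguments, with the usual convention
that it vanishes when `a < 0` or `b < 0` (or `b > a ≥ 0`). -/
def intChoose (a b : ℤ) : ℕ :=
  if 0 ≤ a ∧ 0 ≤ b then a.toNat.choose b.toNat else 0

/-- The length of the maximal cyclic run (mod `n`) of `S` starting at `a`:
the least `l` such that `(a + l) % n ∉ S`. -/
noncomputable def cyclicRunLength (n : ℕ) (S : Finset ℕ) (a : ℕ) : ℕ :=
  sInf {l : ℕ | (a + l) % n ∉ S}

/-- The starting points of the maximal cyclic runs (mod `n`) of `S`. -/
def cyclicRunStarts (n : ℕ) (S : Finset ℕ) : Finset ℕ :=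
  S.filter fun a => (a + (n - 1)) % n ∉ S

/-- The multiset of lengths of the maximal cyclic runs (mod `n`) of `S`.
A subhypergraph (with no isolated vertex) of the hypercycle `C_n^{d,α}` is determined by
its edge index set `S ⊆ {0, …, n-1}`, and it is a disjoint union of line hypergraphs
whose multiset of lengths is `cyclicRunLengthsMultiset n S`. -/
noncomputable def cyclicRunLengthsMultiset (n : ℕ) (S : Finset ℕ) : Multiset ℕ :=
  (cyclicRunStarts n S).val.map (cyclicRunLength n S)

/-- number of compositions of `m` into `r` positive parts -/
def hcComp : ℕ → ℕ → ℕ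
  | 0, 0 => 1
  | 0, _ + 1 => 0
  | _ + 1, 0 => 0
  | m + 1, r + 1 => m.choose r

theorem hcComp_pascal (m r : ℕ) : hcComp (m + 1) (r + 1) = hcComp m (r + 1) + hcComp m r := by
  cases m with
  | zero => cases r <;> simp [hcComp]
  | succ m =>
    cases r with
    | zero => simp [hcComp]
    | succ r => simp only [hcComp]; rw [Nat.choose_succ_succ, add_comm]

theorem hcComp_sum (m r : ℕ) : ∑ k ∈ Finset.range m, hcComp k r = hcComp m (r + 1) := by
  induction m with
  | zero => simp [hcComp]
  | succ m ih => rw [Finset.sum_range_succ, ih, hcComp_pascal]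

theorem hcComp_sum' (m r : ℕ) : ∑ g ∈ Finset.Icc 1 m, hcComp (m - g) r = hcComp m (r + 1) := by
  rw [← hcComp_sum]
  apply Finset.sum_nbij' (fun g => m - g) (fun k => m - k)
  all_goals simp
  all_goals intros
  all_goals omega

theorem hcRun_eq {n : ℕ} {S : Finset ℕ} {a k : ℕ} (h1 : (a + k) % n ∉ S)
    (h2 : ∀ j < k, (a + j) % n ∈ S) : cyclicRunLength n S a = k := by
  unfold cyclicRunLength
  apply le_antisymm
  · exact Nat.sInf_le h1
  · apply le_csInf ⟨k, h1⟩
    intro j hj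
    by_contra hlt
    exact hj (h2 j (by omega))

theorem hcRun_spec {n : ℕ} {S : Finset ℕ} {a m : ℕ} (h1 : (a + m) % n ∉ S) :
    (a + cyclicRunLength n S a) % n ∉ S ∧ (∀ j < cyclicRunLength n S a, (a + j) % n ∈ S) ∧
    cyclicRunLength n S a ≤ m := by
  refine ⟨Nat.sInf_mem (s := {l : ℕ | (a + l) % n ∉ S}) ⟨m, h1⟩, ?_, Nat.sInf_le h1⟩
  intro j hj
  by_contra h
  exact Nat.notMem_of_lt_sInf hj h

theorem hc_prev_pos {n a : ℕ} (ha : 0 < a) (h : a < n) : (a + (n - 1)) % n = a - 1 := by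
  have : a + (n - 1) = (a - 1) + n := by omega
  rw [this, Nat.add_mod_right, Nat.mod_eq_of_lt (by omega)]

theorem hc_prev_zero {n : ℕ} (h : 0 < n) : (0 + (n - 1)) % n = n - 1 := by
  rw [zero_add, Nat.mod_eq_of_lt (by omega)]

/-- sets that begin with a run at `0` and end with a gap -/
def hcLin (n : ℕ) (S : Finset ℕ) : Prop := n = 0 ∨ (0 ∈ S ∧ n - 1 ∉ S)

/-- prepend a run of length `p` and a gap of length `g` -/
def hcGlue (p g : ℕ) (S : Finset ℕ) : Finset ℕ :=
  Finset.range p ∪ S.image (fun x => x + (p + g))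

theorem mem_hcGlue {p g : ℕ} {S : Finset ℕ} {x : ℕ} :
    x ∈ hcGlue p g S ↔ x < p ∨ (p + g ≤ x ∧ x - (p + g) ∈ S) := by
  unfold hcGlue
  simp only [Finset.mem_union, Finset.mem_range, Finset.mem_image]
  constructor
  · rintro (h | ⟨y, hy, rfl⟩)
    · exact Or.inl h
    · right; simpa using hy
  · rintro (h | ⟨h1, h2⟩)
    · exact Or.inl h
    · exact Or.inr ⟨_, h2, by omega⟩

theorem hcGlue_add {p g : ℕ} {S : Finset ℕ} {x : ℕ} :
    x + (p + g) ∈ hcGlue p g S ↔ x ∈ S := by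
  rw [mem_hcGlue]
  simp
  omega

theorem hcGlue_runs {p g n : ℕ} {S : Finset ℕ} (hp : 0 < p) (hg : 0 < g)
    (hS : S ⊆ Finset.range n) (hl : hcLin n S) :
    cyclicRunLengthsMultiset (p + g + n) (hcGlue p g S) =
      p ::ₘ cyclicRunLengthsMultiset n S := by
  have hlt : ∀ x ∈ S, x < n := fun x hx => by simpa using hS hx
  have hlast : n - 1 ∉ S := by
    rcases hl with h | h
    · intro h'; have := hlt _ h'; omega
    · exact h.2
  have hst : cyclicRunStarts (p + g + n) (hcGlue p g S) =
      insert 0 ((cyclicRunStarts n S).image (fun x => x + (p + g))) := by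
    ext a
    unfold cyclicRunStarts
    simp only [Finset.mem_filter, Finset.mem_insert, Finset.mem_image]
    rcases Nat.eq_zero_or_pos a with rfl | ha
    · rw [hc_prev_zero (by omega)]
      simp only [true_or, iff_true]
      refine ⟨mem_hcGlue.2 (Or.inl hp), ?_⟩
      rw [mem_hcGlue]
      rintro (h | ⟨h1, h2⟩)
      · omega
      · apply hlast
        rwa [show n - 1 = p + g + n - 1 - (p + g) by omega]
    · constructor
      · rintro ⟨h1, h2⟩
        right
        rw [mem_hcGlue] at h1
        rcases h1 with h1 | ⟨h1, h3⟩
        · rw [hc_prev_pos ha (by omega)] at h2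
          exact absurd (mem_hcGlue.2 (Or.inl (by omega))) h2
        · have := hlt _ h3
          rw [hc_prev_pos ha (by omega)] at h2
          refine ⟨a - (p + g), ⟨h3, ?_⟩, by omega⟩
          rcases Nat.eq_zero_or_pos (a - (p + g)) with h0 | h0
          · rw [h0, hc_prev_zero (by omega)]; exact hlast
          · rw [hc_prev_pos h0 this]
            intro h4
            apply h2
            rw [mem_hcGlue]
            right
            refine ⟨by omega, ?_⟩
            rwa [show a - 1 - (p + g) = a - (p + g) - 1 by omega]
      · rintro (h | ⟨b, ⟨h1, h2⟩, rfl⟩)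
        · omega
        · refine ⟨hcGlue_add.2 h1, ?_⟩
          have := hlt _ h1
          rw [hc_prev_pos ha (by omega), mem_hcGlue]
          rintro (h | ⟨h3, h4⟩)
          · omega
          · rw [hc_prev_pos (by omega) this] at h2
            apply h2
            rwa [show b - 1 = b + (p + g) - 1 - (p + g) by omega]
  unfold cyclicRunLengthsMultiset
  rw [hst, Finset.insert_val_of_notMem, Multiset.map_cons, Finset.image_val_of_injOn,
    Multiset.map_map]
  · congr 1
    · apply hcRun_eq
      · rw [zero_add, Nat.mod_eq_of_lt (by omega), mem_hcGlue]; omega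
      · intro j hj
        rw [zero_add, Nat.mod_eq_of_lt (by omega), mem_hcGlue]; omega
    · apply Multiset.map_congr rfl
      intro b hb
      have hb' : b ∈ S := (Finset.mem_filter.1 hb).1
      have hbn := hlt _ hb'
      have hm : (b + (n - 1 - b)) % n ∉ S := by
        rwa [show b + (n - 1 - b) = n - 1 by omega, Nat.mod_eq_of_lt (by omega)]
      obtain ⟨h1, h2, h3⟩ := hcRun_spec hm
      simp only [Function.comp]
      apply hcRun_eq
      · rw [Nat.mod_eq_of_lt (by omega)] at h1 ⊢
        rw [add_right_comm, hcGlue_add]; exact h1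
      · intro j hj
        have := h2 j hj
        rw [Nat.mod_eq_of_lt (by omega)] at this ⊢
        rw [add_right_comm, hcGlue_add]; exact this
  · intro x _ y _ h
    simpa using h
  · simp; omega

open Classical in
/-- linear sets with prescribed run lengths -/
noncomputable def hcA (n : ℕ) (M : Multiset ℕ) : Finset (Finset ℕ) :=
  (Finset.range n).powerset.filter fun S => hcLin n S ∧ cyclicRunLengthsMultiset n S = M

theorem mem_hcA {n : ℕ} {M : Multiset ℕ} {S : Finset ℕ} :
    S ∈ hcA n M ↔ S ⊆ Finset.range n ∧ hcLin n S ∧ cyclicRunLengthsMultiset n S = M := by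
  simp [hcA]

theorem hcGlue_sub {p g n : ℕ} {S : Finset ℕ} (hS : S ⊆ Finset.range n) :
    hcGlue p g S ⊆ Finset.range (p + g + n) := by
  intro x hx
  rw [mem_hcGlue] at hx
  rw [Finset.mem_range]
  rcases hx with h | ⟨h1, h2⟩
  · omega
  · have := Finset.mem_range.1 (hS h2); omega

theorem hcGlue_lin {p g n : ℕ} {S : Finset ℕ} (hp : 0 < p) (hg : 0 < g)
    (hS : S ⊆ Finset.range n) (hl : hcLin n S) : hcLin (p + g + n) (hcGlue p g S) := by
  right
  refine ⟨mem_hcGlue.2 (Or.inl hp), ?_⟩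
  rw [mem_hcGlue]
  rintro (h | ⟨h1, h2⟩)
  · omega
  · have := Finset.mem_range.1 (hS h2)
    rcases hl with h | h
    · omega
    · apply h.2
      rwa [show n - 1 = p + g + n - 1 - (p + g) by omega]

theorem hc_decomp {n : ℕ} {S : Finset ℕ} (hn : 0 < n) (hS : S ⊆ Finset.range n)
    (hl : hcLin n S) : ∃ p g n' S', 0 < p ∧ 0 < g ∧ n = p + g + n' ∧ S' ⊆ Finset.range n' ∧
      hcLin n' S' ∧ S = hcGlue p g S' := by
  classical
  obtain h | ⟨h0, hlast⟩ := hl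
  · omega
  have hex : ∃ k, k ∉ S := ⟨_, hlast⟩
  obtain ⟨p, hp1, hp2⟩ : ∃ p, p ∉ S ∧ ∀ j < p, j ∈ S :=
    ⟨Nat.find hex, Nat.find_spec hex, fun j hj => by simpa using Nat.find_min hex hj⟩
  have hpn : p ≤ n - 1 := by
    by_contra h
    exact hlast (hp2 _ (by omega))
  have hex2 : ∃ q, p ≤ q ∧ (q ∈ S ∨ q = n) := ⟨n, by omega, Or.inr rfl⟩
  obtain ⟨q, ⟨hq1, hq2⟩, hq3⟩ : ∃ q, (p ≤ q ∧ (q ∈ S ∨ q = n)) ∧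
      ∀ j < q, ¬ (p ≤ j ∧ (j ∈ S ∨ j = n)) :=
    ⟨Nat.find hex2, Nat.find_spec hex2, fun j hj => Nat.find_min hex2 hj⟩
  have hp0 : 0 < p := by
    rcases Nat.eq_zero_or_pos p with rfl | h
    · exact absurd h0 hp1
    · exact h
  have hqn : q ≤ n := by
    rcases hq2 with h | h
    · have := Finset.mem_range.1 (hS h); omega
    · omega
  have hpq : p ≠ q := by
    rintro rfl
    rcases hq2 with h | h
    · exact hp1 h
    · omega
  have hmem : ∀ x, x ∈ (Finset.range (n - q)).filter (fun x => x + q ∈ S) ↔ x + q ∈ S := by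
    intro x
    simp only [Finset.mem_filter, Finset.mem_range, and_iff_right_iff_imp]
    intro h
    have := Finset.mem_range.1 (hS h); omega
  refine ⟨p, q - p, n - q, (Finset.range (n - q)).filter (fun x => x + q ∈ S), hp0, by omega,
    by omega, Finset.filter_subset _ _, ?_, ?_⟩
  · rcases hq2 with h | h
    · rcases Nat.eq_zero_or_pos (n - q) with h' | h'
      · exact Or.inl h'
      · right
        rw [hmem, hmem]
        refine ⟨by simpa using h, ?_⟩
        rwa [show n - q - 1 + q = n - 1 by omega]
    · left; omega
  · ext x
    rw [mem_hcGlue, hmem]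
    constructor
    · intro hx
      by_cases hxp : x < p
      · exact Or.inl hxp
      · right
        have : q ≤ x := by
          by_contra h
          exact hq3 x (by omega) ⟨by omega, Or.inl hx⟩
        refine ⟨by omega, ?_⟩
        rwa [show x - (p + (q - p)) + q = x by omega]
    · rintro (h | ⟨h1, h2⟩)
      · exact hp2 _ h
      · rwa [show x - (p + (q - p)) + q = x by omega] at h2

theorem hcGlue_inj {p g p' g' n n' : ℕ} {S S' : Finset ℕ} (hg : 0 < g) (hg' : 0 < g')
    (hl : hcLin n S) (hl' : hcLin n' S') 
    (hS : S ⊆ Finset.range n) (hS' : S' ⊆ Finset.range n')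
    (hn : p + g + n = p' + g' + n')
    (h : hcGlue p g S = hcGlue p' g' S') : p = p' ∧ g = g' ∧ S = S' := by
  have key : ∀ x, (x < p ∨ (p + g ≤ x ∧ x - (p + g) ∈ S)) ↔
      (x < p' ∨ (p' + g' ≤ x ∧ x - (p' + g') ∈ S')) := fun x => by
    rw [← mem_hcGlue, ← mem_hcGlue, h]
  have hp : p = p' := by
    rcases lt_trichotomy p p' with h | h | h
    · have := (key p).2 (Or.inl h); omega
    · exact h
    · have := (key p').1 (Or.inl h); omega
  subst hp
  have hgg : g = g' := by
    rcases lt_trichotomy g g' with h | h | h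
    · rcases hl with h0 | h0
      · omega
      · have := (key (p + g)).1 (Or.inr ⟨le_rfl, by simpa using h0.1⟩); omega
    · exact h
    · rcases hl' with h0 | h0
      · omega
      · have := (key (p + g')).2 (Or.inr ⟨le_rfl, by simpa using h0.1⟩); omega
  subst hgg
  refine ⟨rfl, rfl, ?_⟩
  ext x
  rw [← hcGlue_add (p := p) (g := g), h, hcGlue_add]

theorem hcA_rec (n : ℕ) (M : Multiset ℕ) (hM : M ≠ 0) (hpos : ∀ x ∈ M, 0 < x) :
    (hcA n M).card = ∑ p ∈ M.toFinset, ∑ g ∈ Finset.Icc 1 (n - p),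
      (hcA (n - p - g) (M.erase p)).card := by
  simp_rw [← Finset.card_sigma]
  symm
  apply Finset.card_bij (fun x _ => hcGlue x.1 x.2.1 x.2.2)
  · rintro ⟨p, g, S⟩ h
    simp only [Finset.mem_sigma, Multiset.mem_toFinset, Finset.mem_Icc, mem_hcA] at h ⊢
    obtain ⟨hp, ⟨hg, hgn⟩, hS, hl, hR⟩ := h
    have hp0 := hpos _ hp
    have hn : p + g + (n - p - g) = n := by omega
    have e1 := hcGlue_sub (p := p) (g := g) hS
    have e2 := hcGlue_lin hp0 hg hS hl
    have e3 := hcGlue_runs hp0 hg hS hl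
    rw [hn] at e1 e2 e3
    refine ⟨e1, e2, ?_⟩
    rw [e3, hR, Multiset.cons_erase hp]
  · rintro ⟨p, g, S⟩ h ⟨p', g', S'⟩ h' heq
    simp only [Finset.mem_sigma, Multiset.mem_toFinset, Finset.mem_Icc, mem_hcA] at h h' heq
    obtain ⟨hp, ⟨hg, hgn⟩, hS, hl, hR⟩ := h
    obtain ⟨hp', ⟨hg', hgn'⟩, hS', hl', hR'⟩ := h'
    obtain ⟨rfl, rfl, rfl⟩ := hcGlue_inj hg hg' hl hl' hS hS' (by omega) heq
    rfl
  · intro S h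
    obtain ⟨hS, hl, hR⟩ := mem_hcA.1 h
    have hn : 0 < n := by
      rcases Nat.eq_zero_or_pos n with rfl | h
      · have : S = ∅ := by simpa using hS
        subst this
        exact absurd hR.symm (by simpa [cyclicRunLengthsMultiset, cyclicRunStarts] using hM)
      · exact h
    obtain ⟨p, g, n', S', hp, hg, rfl, hS', hl', rfl⟩ := hc_decomp hn hS hl
    have e3 := hcGlue_runs hp hg hS' hl'
    rw [hR] at e3
    refine ⟨⟨p, g, S'⟩, ?_, rfl⟩
    simp only [Finset.mem_sigma, Multiset.mem_toFinset, Finset.mem_Icc, mem_hcA]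
    have e : p + g + n' - p - g = n' := by omega
    rw [e]
    refine ⟨by rw [e3]; simp, by omega, hS', hl', ?_⟩
    rw [e3]; simp

theorem hc_erase_prod (M : Multiset ℕ) (p : ℕ) (hp : p ∈ M) :
    ∏ x ∈ M.toFinset, (M.count x).factorial =
      M.count p * ∏ x ∈ (M.erase p).toFinset, ((M.erase p).count x).factorial := by
  have h1 : ∏ x ∈ (M.erase p).toFinset, ((M.erase p).count x).factorial =
      ∏ x ∈ M.toFinset, ((M.erase p).count x).factorial := by
    apply Finset.prod_subset
    · intro x hx
      rw [Multiset.mem_toFinset] at hx ⊢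
      exact Multiset.mem_of_mem_erase hx
    · intro x _ hx
      rw [Multiset.mem_toFinset] at hx
      rw [Multiset.count_eq_zero_of_notMem hx]; rfl
  have hp' : p ∈ M.toFinset := by simpa using hp
  rw [h1, ← Finset.mul_prod_erase _ _ hp', ← Finset.mul_prod_erase _ _ hp', ← mul_assoc,
    Multiset.count_erase_self, Nat.mul_factorial_pred (Multiset.count_pos.2 hp).ne']
  congr 1
  apply Finset.prod_congr rfl
  intro x hx
  rw [Multiset.count_erase_of_ne (Finset.ne_of_mem_erase hx)]

theorem hc_sum_trunc (n i p r : ℕ) (hpi : p ≤ i) (h : r = 0 → i = p) :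
    ∑ g ∈ Finset.Icc 1 (n - p), hcComp (n - p - g - (i - p)) r = hcComp (n - i) (r + 1) := by
  rw [← hcComp_sum']
  symm
  have : ∀ g, n - p - g - (i - p) = n - i - g := by intro g; omega
  simp_rw [this]
  apply Finset.sum_subset
  · intro g; simp only [Finset.mem_Icc]; omega
  · intro g; simp only [Finset.mem_Icc]; intro h1 h2
    rw [show n - i - g = 0 by omega]
    cases r with
    | zero => have := h rfl; omega
    | succ r => rfl

theorem hcA_card (r : ℕ) : ∀ (n : ℕ) (M : Multiset ℕ), M.card = r → (∀ x ∈ M, 0 < x) →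
    (∏ x ∈ M.toFinset, (M.count x).factorial) * (hcA n M).card =
      r.factorial * hcComp (n - M.sum) r := by
  induction r with
  | zero =>
    intro n M hM _
    rw [Multiset.card_eq_zero] at hM
    subst hM
    cases n with
    | zero =>
      have : hcA 0 0 = {∅} := by
        ext S
        rw [mem_hcA]
        simp only [Finset.range_zero, Finset.subset_empty, Finset.mem_singleton]
        constructor
        · exact fun h => h.1
        · rintro rfl
          simp [hcLin, cyclicRunLengthsMultiset, cyclicRunStarts]
      simp [this, hcComp]
    | succ n =>
      have : hcA (n + 1) 0 = ∅ := by
        rw [Finset.eq_empty_iff_forall_notMem]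
        intro S h
        obtain ⟨h1, h2, h3⟩ := mem_hcA.1 h
        obtain ⟨p, g, n', S', hp, hg, hn, hS', hl', rfl⟩ := hc_decomp (by omega) h1 h2
        rw [hn, hcGlue_runs hp hg hS' hl'] at h3
        simp at h3
      simp [this, hcComp]
  | succ r ih =>
    intro n M hM hpos
    have hM0 : M ≠ 0 := by rintro rfl; simp at hM
    rw [hcA_rec n M hM0 hpos, Finset.mul_sum]
    have : ∀ p ∈ M.toFinset, (∏ x ∈ M.toFinset, (M.count x).factorial) *
        ∑ g ∈ Finset.Icc 1 (n - p), (hcA (n - p - g) (M.erase p)).card =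
        M.count p * (r.factorial * hcComp (n - M.sum) (r + 1)) := by
      intro p hp
      rw [Multiset.mem_toFinset] at hp
      have hs : p + (M.erase p).sum = M.sum := by
        rw [← Multiset.sum_cons, Multiset.cons_erase hp]
      have hc : (M.erase p).card = r := by
        rw [Multiset.card_erase_of_mem hp, hM]; rfl
      rw [hc_erase_prod M p hp, mul_assoc, Finset.mul_sum]
      congr 1
      rw [← hc_sum_trunc n M.sum p r (by omega), Finset.mul_sum]
      · apply Finset.sum_congr rfl
        intro g _
        rw [ih _ _ hc (fun x hx => hpos x (Multiset.mem_of_mem_erase hx))]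
        rw [show M.sum - p = (M.erase p).sum by omega]
      · rintro rfl
        rw [Multiset.card_eq_zero] at hc
        rw [hc] at hs
        simpa using hs.symm
    rw [Finset.sum_congr rfl this, ← Finset.sum_mul, Multiset.toFinset_sum_count_eq, hM,
      Nat.factorial_succ, mul_assoc]

/-- rotation of a subset of `range n` -/
def hcRot (n a : ℕ) (S : Finset ℕ) : Finset ℕ := S.image (fun x => (x + a) % n)

theorem hcRot_sub {n a : ℕ} {S : Finset ℕ} (hn : 0 < n) : hcRot n a S ⊆ Finset.range n := by
  intro x hx
  obtain ⟨y, _, rfl⟩ := Finset.mem_image.1 hx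
  exact Finset.mem_range.2 (Nat.mod_lt _ hn)

theorem mem_hcRot {n a : ℕ} {S : Finset ℕ} (hS : S ⊆ Finset.range n) (x : ℕ) :
    (x + a) % n ∈ hcRot n a S ↔ x % n ∈ S := by
  constructor
  · intro h
    obtain ⟨y, hy, h2⟩ := Finset.mem_image.1 h
    have h3 : y ≡ x [MOD n] := Nat.ModEq.add_right_cancel' a h2
    have h4 := Finset.mem_range.1 (hS hy)
    rw [← h3, Nat.mod_eq_of_lt h4]; exact hy
  · intro h
    refine Finset.mem_image.2 ⟨_, h, ?_⟩
    simp

theorem hcRot_injOn {n a : ℕ} {S : Finset ℕ} (hS : S ⊆ Finset.range n) :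
    Set.InjOn (fun x => (x + a) % n) S := by
  intro x hx y hy h
  have h3 : x ≡ y [MOD n] := Nat.ModEq.add_right_cancel' a h
  exact h3.eq_of_lt_of_lt (Finset.mem_range.1 (hS hx)) (Finset.mem_range.1 (hS hy))

theorem hcRot_inv {n a b : ℕ} {S : Finset ℕ} (hS : S ⊆ Finset.range n) (hab : a + b = n) :
    hcRot n b (hcRot n a S) = S := by
  unfold hcRot
  rw [Finset.image_image]
  conv_rhs => rw [← Finset.image_id (s := S)]
  apply Finset.image_congr
  intro x hx
  have := Finset.mem_range.1 (hS hx)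
  simp [add_assoc, hab, Nat.mod_eq_of_lt this]

theorem hcRot_starts {n a : ℕ} {S : Finset ℕ} (hS : S ⊆ Finset.range n) :
    cyclicRunStarts n (hcRot n a S) = hcRot n a (cyclicRunStarts n S) := by
  have key : ∀ x, ((x + a) % n + (n - 1)) % n ∈ hcRot n a S ↔ (x + (n - 1)) % n ∈ S := by
    intro x
    rw [← mem_hcRot hS (a := a), Nat.mod_add_mod, add_right_comm]
  ext y
  unfold cyclicRunStarts
  simp only [Finset.mem_filter]
  constructor
  · rintro ⟨h1, h2⟩
    obtain ⟨x, hx, rfl⟩ := Finset.mem_image.1 h1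
    exact Finset.mem_image.2 ⟨x, Finset.mem_filter.2 ⟨hx, fun h => h2 ((key x).2 h)⟩, rfl⟩
  · intro h
    obtain ⟨x, hx, rfl⟩ := Finset.mem_image.1 h
    obtain ⟨hx1, hx2⟩ := Finset.mem_filter.1 hx
    exact ⟨Finset.mem_image.2 ⟨x, hx1, rfl⟩, fun h => hx2 ((key x).1 h)⟩

theorem hcRot_runs {n a : ℕ} {S : Finset ℕ} (hS : S ⊆ Finset.range n) :
    cyclicRunLengthsMultiset n (hcRot n a S) = cyclicRunLengthsMultiset n S := by
  unfold cyclicRunLengthsMultiset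
  rw [hcRot_starts hS]
  have hsub : cyclicRunStarts n S ⊆ Finset.range n := (Finset.filter_subset _ _).trans hS
  have hv : (hcRot n a (cyclicRunStarts n S)).val =
      (cyclicRunStarts n S).val.map (fun x => (x + a) % n) :=
    Finset.image_val_of_injOn (hcRot_injOn hsub)
  rw [hv, Multiset.map_map]
  apply Multiset.map_congr rfl
  intro x _
  simp only [Function.comp, cyclicRunLength]
  congr 1
  ext k
  simp only [Set.mem_setOf_eq]
  rw [← mem_hcRot hS (a := a), Nat.mod_add_mod, add_right_comm]

open Classical in
/-- the family being counted -/
noncomputable def hcF (n : ℕ) (M : Multiset ℕ) : Finset (Finset ℕ) :=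
  (Finset.range n).powerset.filter fun S => cyclicRunLengthsMultiset n S = M

theorem mem_hcF {n : ℕ} {M : Multiset ℕ} {S : Finset ℕ} :
    S ∈ hcF n M ↔ S ⊆ Finset.range n ∧ cyclicRunLengthsMultiset n S = M := by
  simp [hcF]

theorem hc_starts_fiber {n a : ℕ} (M : Multiset ℕ) (ha : a < n) :
    ((hcF n M).filter (fun S => a ∈ cyclicRunStarts n S)).card = (hcA n M).card := by
  have hn : 0 < n := by omega
  have hz : ∀ S, hcLin n S ↔ 0 ∈ cyclicRunStarts n S := by
    intro S
    rw [cyclicRunStarts, Finset.mem_filter, hc_prev_zero hn, hcLin]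
    constructor
    · rintro (h | h)
      · omega
      · exact h
    · exact Or.inr
  symm
  apply Finset.card_nbij' (hcRot n a) (hcRot n (n - a))
  · intro S hS
    obtain ⟨h1, h2, h3⟩ := mem_hcA.1 hS
    simp only [Finset.coe_filter, Set.mem_setOf_eq, mem_hcF]
    refine ⟨⟨hcRot_sub hn, by rw [hcRot_runs h1, h3]⟩, ?_⟩
    rw [hcRot_starts h1]
    refine Finset.mem_image.2 ⟨0, (hz S).1 h2, ?_⟩
    rw [zero_add, Nat.mod_eq_of_lt ha]
  · intro S hS
    simp only [Finset.coe_filter, Set.mem_setOf_eq, mem_hcF] at hS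
    obtain ⟨⟨h1, h2⟩, h3⟩ := hS
    refine mem_hcA.2 ⟨hcRot_sub hn, ?_, by rw [hcRot_runs h1, h2]⟩
    rw [hz, hcRot_starts h1]
    refine Finset.mem_image.2 ⟨a, h3, ?_⟩
    rw [show a + (n - a) = n by omega, Nat.mod_self]
  · intro S hS
    exact hcRot_inv (mem_hcA.1 hS).1 (by omega)
  · intro S hS
    simp only [Finset.coe_filter, Set.mem_setOf_eq, mem_hcF] at hS
    exact hcRot_inv hS.1.1 (by omega)

theorem hc_double (n : ℕ) (M : Multiset ℕ) :
    M.card * (hcF n M).card = n * (hcA n M).card := by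
  have h1 : ∑ S ∈ hcF n M, ∑ a ∈ Finset.range n, (if a ∈ cyclicRunStarts n S then 1 else 0) =
      M.card * (hcF n M).card := by
    rw [mul_comm, ← smul_eq_mul]
    apply Finset.sum_eq_card_nsmul 
    intro S hS
    obtain ⟨h1, h2⟩ := mem_hcF.1 hS
    have hsub : cyclicRunStarts n S ⊆ Finset.range n := (Finset.filter_subset _ _).trans h1
    rw [← Finset.sum_filter, Finset.filter_mem_eq_inter, Finset.inter_eq_right.2 hsub, ← h2]
    simp [cyclicRunLengthsMultiset]
  rw [← h1, Finset.sum_comm]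
  conv_rhs => rw [← Finset.card_range n]
  rw [← smul_eq_mul, Finset.card_range]
  conv_rhs => rw [← Finset.card_range n]
  rw [Finset.card_range]
  have h2 : ∀ a ∈ Finset.range n,
      ∑ S ∈ hcF n M, (if a ∈ cyclicRunStarts n S then 1 else 0) = (hcA n M).card := by
    intro a ha
    rw [← hc_starts_fiber M (Finset.mem_range.1 ha), Finset.card_filter]
  rw [Finset.sum_congr rfl h2]
  simp

/-- Let `C_n^{d,α}` be a hypercycle of length `n`, and for positive
integers `s_1 ≤ … ≤ s_r` let `F(s_1,…,s_r,n)` be the set of subhypergraphs of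
`C_n^{d,α}` with no isolated vertex that are disjoint unions of `r` line hypergraphs of
lengths `s_1,…,s_r` (equivalently, the set of edge index sets `S ⊆ {0,…,n-1}` whose
multiset of maximal cyclic run lengths is `{s_1,…,s_r}`).  If `s_1 + ⋯ + s_r = i` and
the multiset `{s_1,…,s_r}` has `t` distinct values with multiplicities `l_1,…,l_t`, then
`|F(s_1,…,s_r,n)| = (n·(r-1)! / (l_1! ⋯ l_t!)) · C(n - i - 1, r - 1)`. -/
theorem card_hypercycle_subhypergraphs (n r t i : ℕ) (s : Fin r → ℕ) (l : Fin t → ℕ)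
    (val : Fin t → ℕ)
    (hr : 0 < r)
    (hmono : Monotone s)
    (hpos : ∀ u, 0 < s u)
    (hsum : ∑ u, s u = i)
    (hval : StrictMono val)
    (hvals : ((Finset.univ.val.map s : Multiset ℕ)).toFinset = Finset.image val Finset.univ)
    (hl : ∀ u : Fin t, l u = ((Finset.univ.val.map s : Multiset ℕ)).count (val u)) :
    (∏ u, (l u).factorial) *
        {S : Finset ℕ | S ⊆ Finset.range n ∧
          cyclicRunLengthsMultiset n S = Finset.univ.val.map s}.ncard =
      n * (r - 1).factorial * intChoose ((n : ℤ) - i - 1) ((r : ℤ) - 1) := by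
  classical
  set M : Multiset ℕ := Finset.univ.val.map s with hMdef
  have hcard : M.card = r := by simp [hMdef]
  have hMpos : ∀ x ∈ M, 0 < x := by
    intro x hx
    obtain ⟨u, _, rfl⟩ := Multiset.mem_map.1 hx
    exact hpos u
  have hMsum : M.sum = i := hsum
  have hset : {S : Finset ℕ | S ⊆ Finset.range n ∧ cyclicRunLengthsMultiset n S = M} =
      ((hcF n M : Finset (Finset ℕ)) : Set (Finset ℕ)) := by
    ext S
    simp [mem_hcF]
  have hprod : ∏ u, (l u).factorial = ∏ x ∈ M.toFinset, (M.count x).factorial := by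
    rw [hvals, Finset.prod_image (fun x _ y _ h => hval.injective h)]
    exact Finset.prod_congr rfl (fun u _ => by rw [hl])
  have hi : 0 < i := by
    rw [← hsum]
    exact Finset.sum_pos (fun u _ => hpos u) ⟨⟨0, hr⟩, Finset.mem_univ _⟩
  have hchoose : hcComp (n - i) r = intChoose ((n : ℤ) - i - 1) ((r : ℤ) - 1) := by
    obtain ⟨r', rfl⟩ : ∃ r', r = r' + 1 := ⟨r - 1, by omega⟩
    unfold intChoose
    by_cases h : i < n
    · obtain ⟨m, rfl⟩ : ∃ m, n = i + m + 1 := ⟨n - i - 1, by omega⟩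
      rw [if_pos (by omega), show i + m + 1 - i = m + 1 by omega]
      rw [show (((i + m + 1 : ℕ) : ℤ) - i - 1).toNat = m by omega,
        show (((r' + 1 : ℕ) : ℤ) - 1).toNat = r' by omega]
      rfl
    · rw [if_neg (by omega), show n - i = 0 by omega]
      rfl
  rw [hset, Set.ncard_coe_finset, hprod, ← hchoose]
  apply Nat.eq_of_mul_eq_mul_left hr
  have h1 := hcA_card r n M hcard hMpos
  have h2 := hc_double n M
  rw [hcard] at h2
  rw [hMsum] at h1
  rw [mul_left_comm, h2, mul_left_comm, h1, ← Nat.mul_factorial_pred hr.ne']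
  ring
end

section
/- Let C_n^{d,alpha} be a hypercycle with d > 2*alpha and let i < n. Then for every r with 1 ≤ r ≤ i, beta_{i, i*d - alpha*(i-r)}(R/I(C_n^{d,alpha})) = (n/r) * C(i-1, r-1) * C(n-i-1, r-1), and beta_{i,j}(R/I(C_n^{d,alpha})) = 0 for every j not of the form i*d - alpha*(i-r). -/
open MvPolynomial

/-- A *minimal graded free resolution* of `R ⧸ I`, where `R = k[x_v : v ∈ V]` is the
polynomial ring with its standard grading.  The `i`-th free module is
`⨁_j R(-j)^{β i j}`, encoded as finitely supported functions on `Σ j, Fin (β i j)`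
(the basis element `⟨j, t⟩` having degree `j`).  The graded Betti number
`β_{i,j}(R ⧸ I) = dim_k Tor_i^R(R ⧸ I, k)_j` equals `β i j` for any such resolution. -/
structure MinimalGradedFreeResolution (k V : Type) [Field k] [Fintype V] [DecidableEq V]
    (I : Ideal (MvPolynomial V k)) where
  /-- the ranks: `β i j` copies of `R(-j)` in homological degree `i` -/
  β : ℕ → ℕ → ℕ
  /-- the `0`-th free module is a single copy of `R` generated in degree `0` -/
  β_zero : ∀ j, β 0 j = if j = 0 then 1 else 0
  /-- the differentials -/
  d : ∀ i : ℕ,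
    ((Σ j : ℕ, Fin (β (i + 1) j)) →₀ MvPolynomial V k) →ₗ[MvPolynomial V k]
      ((Σ j : ℕ, Fin (β i j)) →₀ MvPolynomial V k)
  /-- the augmentation onto `R ⧸ I` -/
  aug : ((Σ j : ℕ, Fin (β 0 j)) →₀ MvPolynomial V k) →ₗ[MvPolynomial V k]
      (MvPolynomial V k ⧸ I)
  aug_surjective : Function.Surjective aug
  /-- exactness at homological degree `0` -/
  exact_zero : LinearMap.ker aug = LinearMap.range (d 0)
  /-- exactness at homological degree `i + 1` -/
  exact_succ : ∀ i, LinearMap.ker (d i) = LinearMap.range (d (i + 1))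
  /-- minimality: the image of each differential lies in `m · F`, where `m = (x_v : v ∈ V)` -/
  minimal : ∀ i x p, constantCoeff ((d i x) p) = 0
  /-- the differentials are graded: the image of a degree-`j` basis vector is homogeneous
  of degree `j` -/
  graded : ∀ (i j : ℕ) (t : Fin (β (i + 1) j)) (p : Σ j' : ℕ, Fin (β i j')),
      ((d i (Finsupp.single ⟨j, t⟩ 1)) p).IsHomogeneous (j - p.1) ∧
        (p.1 ≤ j ∨ (d i (Finsupp.single ⟨j, t⟩ 1)) p = 0)

/-- The edge ideal `I(H)` of a hypergraph with edges `E 0, …, E (n-1)`: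
the ideal generated by the squarefree monomials `x^{E i} = ∏_{v ∈ E i} x_v`. -/
noncomputable def edgeIdeal (k : Type) {V : Type} [Field k] [Fintype V] [DecidableEq V]
    {n : ℕ} (E : Fin n → Finset V) : Ideal (MvPolynomial V k) :=
  Ideal.span (Set.range fun i => ∏ v ∈ E i, (X v : MvPolynomial V k))

/-- `E 0, …, E (n-1)` are the edges of a hypercycle `C_n^{d,α}`, whose vertex set is all
of `V` (the union of the edges): each edge has `d` vertices, two distinct edges intersect
exactly when they are cyclically consecutive (indices mod `n`), and cyclically
consecutive edges meet in `α` vertices. -/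
structure IsHypercycle {V : Type} [DecidableEq V] (n d α : ℕ) (E : ℕ → Finset V) :
    Prop where
  card_eq : ∀ i < n, (E i).card = d
  inter_nonempty_iff : ∀ i < n, ∀ j < n, i ≠ j →
    ((E i ∩ E j).Nonempty ↔ ((i + 1) % n = j ∨ (j + 1) % n = i))
  inter_card : ∀ i < n, (E i ∩ E ((i + 1) % n)).card = α
  cover : ∀ v : V, ∃ i < n, v ∈ E i


/-- Graded minimal resolutions with arbitrary index types. -/
structure GRes (k V : Type) [Field k] [Fintype V] [DecidableEq V]
    (I : Ideal (MvPolynomial V k)) where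
  ι : ℕ → Type
  deg : ∀ i, ι i → ℕ
  d : ∀ i, (ι (i + 1) →₀ MvPolynomial V k) →ₗ[MvPolynomial V k] (ι i →₀ MvPolynomial V k)
  pt : ι 0
  pt_uniq : ∀ p, p = pt
  deg_pt : deg 0 pt = 0
  range_zero : ∀ y, (∃ x, d 0 x = y) ↔ y pt ∈ I
  exact_succ : ∀ i y, d i y = 0 ↔ ∃ x, d (i + 1) x = y
  minimal : ∀ i x p, constantCoeff ((d i x) p) = 0
  graded : ∀ i q p m, coeff m ((d i (Finsupp.single q 1)) p) ≠ 0 →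
    m.degree + deg i p = deg (i + 1) q

section compare

set_option linter.unusedSectionVars false

variable {k V : Type} [Field k] [Fintype V] [DecidableEq V]

/-- all the terms of `x` have degree in `J` -/
def HomIn {ι : Type} (deg : ι → ℕ) (J : Set ℕ) (x : ι →₀ MvPolynomial V k) : Prop :=
  ∀ p m, coeff m (x p) ≠ 0 → m.degree + deg p ∈ J

lemma HomIn.add {ι : Type} {deg : ι → ℕ} {J : Set ℕ} {x y : ι →₀ MvPolynomial V k}
    (hx : HomIn deg J x) (hy : HomIn deg J y) : HomIn deg J (x + y) := by
  intro p m h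
  by_cases h1 : coeff m (x p) = 0
  · refine hy p m ?_
    simpa [h1] using h
  · exact hx p m h1

lemma HomIn.neg {ι : Type} {deg : ι → ℕ} {J : Set ℕ} {x : ι →₀ MvPolynomial V k}
    (hx : HomIn deg J x) : HomIn deg J (-x) := by
  intro p m h
  refine hx p m ?_
  simpa using h

lemma homIn_decomp {ι : Type} (deg : ι → ℕ) (J : Set ℕ) (x : ι →₀ MvPolynomial V k) :
    ∃ y z, x = y + z ∧ HomIn deg J y ∧ HomIn deg Jᶜ z := by
  classical
  induction x using Finsupp.induction_linear with
  | zero => exact ⟨0, 0, by simp, fun p m h => by simp at h, fun p m h => by simp at h⟩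
  | add x x' h h' =>
    obtain ⟨y, z, e, hy, hz⟩ := h
    obtain ⟨y', z', e', hy', hz'⟩ := h'
    exact ⟨y + y', z + z', by rw [e, e']; abel, hy.add hy', hz.add hz'⟩
  | single p a =>
    induction a using MvPolynomial.induction_on' with
    | monomial m0 b =>
      have key : ∀ K : Set ℕ, m0.degree + deg p ∈ K →
          HomIn deg K (Finsupp.single p (monomial m0 b : MvPolynomial V k)) := by
        intro K hK p' m h
        rw [Finsupp.single_apply] at h
        split_ifs at h with h1
        · subst h1
          rw [coeff_monomial] at h
          split_ifs at h with h2
          · subst h2; simpa using hK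
          · simp at h
        · simp at h
      by_cases hJ : m0.degree + deg p ∈ J
      · exact ⟨_, 0, by simp, key J hJ, fun p m h => by simp at h⟩
      · exact ⟨0, _, by simp, fun p m h => by simp at h, key Jᶜ hJ⟩
    | add x x' h h' =>
      obtain ⟨y, z, e, hy, hz⟩ := h
      obtain ⟨y', z', e', hy', hz'⟩ := h'
      exact ⟨y + y', z + z', by rw [Finsupp.single_add, e, e']; abel, hy.add hy', hz.add hz'⟩

lemma map_eq_sum {ι κ : Type}
    (φ : (ι →₀ MvPolynomial V k) →ₗ[MvPolynomial V k] (κ →₀ MvPolynomial V k))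
    (x : ι →₀ MvPolynomial V k) (p : κ) :
    φ x p = ∑ q ∈ x.support, x q * φ (Finsupp.single q 1) p := by
  conv_lhs => rw [← Finsupp.sum_single x]
  rw [Finsupp.sum, map_sum, Finsupp.finsetSum_apply]
  refine Finset.sum_congr rfl fun q _ => ?_
  have : (Finsupp.single q (x q) : ι →₀ MvPolynomial V k) = x q • Finsupp.single q 1 := by simp
  rw [this, map_smul]; simp

lemma HomIn.map {ι κ : Type} {deg : ι → ℕ} {deg' : κ → ℕ} {J : Set ℕ}
    (φ : (ι →₀ MvPolynomial V k) →ₗ[MvPolynomial V k] (κ →₀ MvPolynomial V k))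
    (hφ : ∀ q p m, coeff m (φ (Finsupp.single q 1) p) ≠ 0 → m.degree + deg' p = deg q)
    {x : ι →₀ MvPolynomial V k} (hx : HomIn deg J x) : HomIn deg' J (φ x) := by
  classical
  intro p m h
  rw [map_eq_sum, coeff_sum] at h
  obtain ⟨q, -, hq⟩ := Finset.exists_ne_zero_of_sum_ne_zero h
  rw [coeff_mul] at hq
  obtain ⟨⟨m1, m2⟩, hm, h2⟩ := Finset.exists_ne_zero_of_sum_ne_zero hq
  have e := Finset.HasAntidiagonal.mem_antidiagonal.1 hm
  simp only at e h2
  have a1 := hx q m1 (left_ne_zero_of_mul h2)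
  have a2 := hφ q p m2 (right_ne_zero_of_mul h2)
  rw [← e, map_add, add_assoc, a2]; exact a1

lemma cc_map {ι κ : Type}
    (φ : (ι →₀ MvPolynomial V k) →ₗ[MvPolynomial V k] (κ →₀ MvPolynomial V k))
    {x : ι →₀ MvPolynomial V k} (hx : ∀ q, constantCoeff (x q) = 0) (p : κ) :
    constantCoeff (φ x p) = 0 := by
  rw [map_eq_sum, map_sum]
  exact Finset.sum_eq_zero fun q _ => by rw [map_mul, hx, zero_mul]

lemma graded_lift {ι κ : Type} {deg : ι → ℕ} {deg' : κ → ℕ} {j : ℕ}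
    (φ : (ι →₀ MvPolynomial V k) →ₗ[MvPolynomial V k] (κ →₀ MvPolynomial V k))
    (hφ : ∀ q p m, coeff m (φ (Finsupp.single q 1) p) ≠ 0 → m.degree + deg' p = deg q)
    {y : κ →₀ MvPolynomial V k} (hy : HomIn deg' {j} y) (h : ∃ x, φ x = y) :
    ∃ x, φ x = y ∧ HomIn deg {j} x := by
  obtain ⟨x, hx⟩ := h
  obtain ⟨a, b, e, ha, hb⟩ := homIn_decomp deg {j} x
  have ha' := ha.map (deg' := deg') φ hφ
  have hb' := hb.map (deg' := deg') φ hφ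
  have hb'' : φ b = y + -(φ a) := by rw [← hx, e, map_add]; abel
  refine ⟨a, ?_, ha⟩
  have h0 : φ b = 0 := by
    ext p m
    by_contra hne
    have h1 := hb' p m (by simpa using hne)
    rw [hb''] at hne
    exact h1 ((hy.add ha'.neg) p m (by simpa using hne))
  rw [← hx, e, map_add, h0, add_zero]

lemma homIn_single {ι : Type} (deg : ι → ℕ) (q : ι) :
    HomIn deg {deg q} (Finsupp.single q (1 : MvPolynomial V k)) := by
  classical
  intro p m h
  rw [Finsupp.single_apply] at h
  split_ifs at h with h1
  · subst h1
    rw [coeff_one] at h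
    split_ifs at h with h2
    · subst h2; simp
    · simp at h
  · simp at h

variable {I : Ideal (MvPolynomial V k)}

lemma compare (A B : GRes k V I) (i : ℕ) :
    ∃ (f : (A.ι i →₀ MvPolynomial V k) →ₗ[MvPolynomial V k] (B.ι i →₀ MvPolynomial V k))
      (g : (B.ι i →₀ MvPolynomial V k) →ₗ[MvPolynomial V k] (A.ι i →₀ MvPolynomial V k))
      (s : (A.ι i →₀ MvPolynomial V k) →ₗ[MvPolynomial V k] (A.ι i →₀ MvPolynomial V k)),
      (∀ q p m, coeff m (f (Finsupp.single q 1) p) ≠ 0 → m.degree + B.deg i p = A.deg i q) ∧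
      (∀ x, ∃ y, B.d i y = f (A.d i x)) ∧
      (∀ x, ∃ y, A.d i y = g (B.d i x)) ∧
      (∀ x p, constantCoeff (s x p) = 0) ∧
      (∀ x, s (A.d i x) = 0) ∧
      (∀ x, ∃ y, A.d i y = x - g (f x) - s x) := by
  classical
  induction i with
  | zero =>
    have hA : ∀ x : A.ι 0 →₀ MvPolynomial V k, x = Finsupp.single A.pt (x A.pt) := by
      intro x; ext p : 1; rw [A.pt_uniq p]; simp
    have hB : ∀ x : B.ι 0 →₀ MvPolynomial V k, x = Finsupp.single B.pt (x B.pt) := by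
      intro x; ext p : 1; rw [B.pt_uniq p]; simp
    refine ⟨Finsupp.lsingle B.pt ∘ₗ Finsupp.lapply A.pt,
      Finsupp.lsingle A.pt ∘ₗ Finsupp.lapply B.pt, 0, ?_, ?_, ?_, ?_, ?_, ?_⟩
    · intro q p m h
      rw [A.pt_uniq q, B.pt_uniq p] at h ⊢
      simp only [LinearMap.comp_apply, Finsupp.lapply_apply, Finsupp.lsingle_apply,
        Finsupp.single_eq_same, coeff_one] at h
      rw [A.deg_pt, B.deg_pt]
      split_ifs at h with h2
      · subst h2; simp
      · simp at h
    · intro x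
      rw [B.range_zero]
      simpa using (A.range_zero (A.d 0 x)).1 ⟨x, rfl⟩
    · intro x
      rw [A.range_zero]
      simpa using (B.range_zero (B.d 0 x)).1 ⟨x, rfl⟩
    · intro x p; simp
    · intro x; simp
    · intro x
      refine ⟨0, ?_⟩
      conv_rhs => rw [hA x]
      simp
  | succ i ih =>
    obtain ⟨f, g, s, hf, hfd, hgd, hs, hsd, hh⟩ := ih
    have h1 : ∀ q, ∃ x, B.d i x = f (A.d i (Finsupp.single q 1)) ∧
        HomIn (B.deg (i + 1)) {A.deg (i + 1) q} x := by
      intro q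
      refine graded_lift _ (B.graded i) ?_ (hfd _)
      exact HomIn.map f hf (HomIn.map _ (A.graded i) (homIn_single _ q))
    choose F hF hF' using h1
    have h2 : ∀ q, ∃ x, A.d i x = g (B.d i (Finsupp.single q 1)) := fun q => hgd _
    choose G hG using h2
    have h3 : ∀ q, ∃ x, A.d i x = (Finsupp.single q 1) - g (f (Finsupp.single q 1)) -
      s (Finsupp.single q 1) := fun q => hh _
    choose H hH using h3
    set f' := Finsupp.linearCombination (MvPolynomial V k) F with f'def
    set g' := Finsupp.linearCombination (MvPolynomial V k) G with g'def
    set h' := Finsupp.linearCombination (MvPolynomial V k) H with h'def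
    have ef : ∀ x, B.d i (f' x) = f (A.d i x) := by
      intro x
      have : (B.d i) ∘ₗ f' = f ∘ₗ A.d i := by
        ext q : 2; simp [f'def, hF]
      exact LinearMap.congr_fun this x
    have eg : ∀ x, A.d i (g' x) = g (B.d i x) := by
      intro x
      have : (A.d i) ∘ₗ g' = g ∘ₗ B.d i := by
        ext q : 2; simp [g'def, hG]
      exact LinearMap.congr_fun this x
    have eh : ∀ x, A.d i (h' x) = x - g (f x) - s x := by
      intro x
      have : (A.d i) ∘ₗ h' = LinearMap.id - g ∘ₗ f - s := by
        ext q : 2; simp [h'def, hH]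
      exact LinearMap.congr_fun this x
    have dA : ∀ x, A.d i (A.d (i + 1) x) = 0 := fun x => (A.exact_succ i _).2 ⟨x, rfl⟩
    have dB : ∀ x, B.d i (B.d (i + 1) x) = 0 := fun x => (B.exact_succ i _).2 ⟨x, rfl⟩
    refine ⟨f', g', h' ∘ₗ A.d i, ?_, ?_, ?_, ?_, ?_, ?_⟩
    · intro q p m h
      refine hF' q p m ?_
      simpa [f'def] using h
    · intro x
      rw [← B.exact_succ, ef, dA, map_zero]
    · intro x
      rw [← A.exact_succ, eg, dB, map_zero]
    · intro x p
      exact cc_map h' (A.minimal i x) p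
    · intro x
      simp [dA]
    · intro x
      rw [← A.exact_succ]
      simp only [map_sub, LinearMap.comp_apply, eg, ef, eh, hsd]
      abel

lemma card_le (A B : GRes k V I) (i j : ℕ) [Finite {p : B.ι i // B.deg i p = j}] :
    Nat.card {p : A.ι i // A.deg i p = j} ≤ Nat.card {p : B.ι i // B.deg i p = j} := by
  classical
  obtain ⟨f, g, s, hf, -, -, hs, -, hh⟩ := compare A B i
  have := Fintype.ofFinite {p : B.ι i // B.deg i p = j}
  let v : {p : A.ι i // A.deg i p = j} → ({p : B.ι i // B.deg i p = j} → k) :=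
    fun q p => constantCoeff (f (Finsupp.single q.1 1) p.1)
  have hv : LinearIndependent k v := by
    rw [linearIndependent_iff']
    intro t c hc q0 hq0
    let y : A.ι i →₀ MvPolynomial V k := ∑ q ∈ t, Finsupp.single q.1 (C (c q))
    have hy : ∀ p, constantCoeff (f y p) = 0 := by
      intro p
      have e1 : f y p = ∑ q ∈ t, C (c q) * f (Finsupp.single q.1 1) p := by
        simp only [y, map_sum, Finsupp.finsetSum_apply]
        refine Finset.sum_congr rfl fun q _ => ?_
        have : (Finsupp.single q.1 (C (c q)) : A.ι i →₀ MvPolynomial V k)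
          = (C (c q) : MvPolynomial V k) • Finsupp.single q.1 1 := by simp
        rw [this, map_smul]; simp
      rw [e1, map_sum]
      by_cases hp : B.deg i p = j
      · have := congrFun hc ⟨p, hp⟩
        simpa [v] using this
      · refine Finset.sum_eq_zero fun q _ => ?_
        rw [map_mul]
        have : constantCoeff (f (Finsupp.single q.1 1) p) = 0 := by
          by_contra h
          have := hf q.1 p 0 h
          rw [q.2] at this
          simp at this
          exact hp this
        rw [this, mul_zero]
    have hgf := cc_map g hy
    obtain ⟨z, hz⟩ := hh y
    have h2 : ∀ p, constantCoeff (y p) = 0 := by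
      cases i with
      | zero =>
        intro p
        have h3 := A.minimal 0 z p
        rw [hz] at h3
        simpa [hgf, hs] using h3
      | succ i =>
        intro p
        have h3 := A.minimal _ z p
        rw [hz] at h3
        simpa [hgf, hs] using h3
    have h3 := h2 q0.1
    simp only [y, Finsupp.finsetSum_apply, map_sum] at h3
    rw [Finset.sum_eq_single q0] at h3
    · simpa using h3
    · intro b _ hb
      have : b.1 ≠ q0.1 := fun h => hb (Subtype.ext h)
      simp [this]
    · intro h; exact absurd hq0 h
  have hfin : Finite {p : A.ι i // A.deg i p = j} := hv.finite
  have := Fintype.ofFinite {p : A.ι i // A.deg i p = j}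
  have h := hv.fintype_card_le_finrank
  simpa [Nat.card_eq_fintype_card] using h

end compare

section taylor

set_option linter.unusedSectionVars false

variable {k V : Type} [Field k] [Fintype V] [DecidableEq V] {n : ℕ}

/-- exponent of the lcm of the generators in `S` -/
noncomputable def tU (E : Fin n → Finset V) (S : Finset (Fin n)) : V →₀ ℕ :=
  ∑ v ∈ S.biUnion E, Finsupp.single v 1

lemma tU_apply (E : Fin n → Finset V) (S : Finset (Fin n)) (v : V) :
    tU E S v = if v ∈ S.biUnion E then 1 else 0 := by
  simp only [tU, Finsupp.finsetSum_apply, Finsupp.single_apply]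
  rw [Finset.sum_ite_eq']

lemma tU_mono (E : Fin n → Finset V) {S T : Finset (Fin n)} (h : S ⊆ T) : tU E S ≤ tU E T := by
  intro v
  rw [tU_apply, tU_apply]
  have := Finset.biUnion_subset_biUnion_of_subset_left E h
  split_ifs with h1 h2
  · exact le_rfl
  · exact absurd (this h1) h2
  · exact zero_le_one
  · exact le_rfl

lemma tU_degree (E : Fin n → Finset V) (S : Finset (Fin n)) :
    (tU E S).degree = (S.biUnion E).card := by
  simp [tU, map_sum]

lemma tU_le_of (E : Fin n → Finset V) {S : Finset (Fin n)} {a : V →₀ ℕ}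
    (h : ∀ s ∈ S, tU E {s} ≤ a) : tU E S ≤ a := by
  intro v
  rw [tU_apply]
  split_ifs with h1
  · obtain ⟨s, hs, hv⟩ := Finset.mem_biUnion.1 h1
    have := h s hs v
    rw [tU_apply] at this
    simpa [hv] using this
  · exact Nat.zero_le _

def tsg (s : Fin n) (S : Finset (Fin n)) : ℤ := (-1) ^ (S.filter (· < s)).card

/-- the basis vector of multidegree `a` at `S` -/
noncomputable def tw (k : Type) [Field k] (E : Fin n → Finset V) (a : V →₀ ℕ)
    (S : Finset (Fin n)) : Finset (Fin n) →₀ MvPolynomial V k :=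
  Finsupp.single S (monomial (a - tU E S) 1)

noncomputable def tD (k : Type) [Field k] (E : Fin n → Finset V) :
    (Finset (Fin n) →₀ MvPolynomial V k) →ₗ[MvPolynomial V k]
      (Finset (Fin n) →₀ MvPolynomial V k) :=
  Finsupp.linearCombination _ fun S => ∑ s ∈ S, tsg s S • tw k E (tU E S) (S.erase s)

lemma tD_single (E : Fin n → Finset V) (S : Finset (Fin n)) :
    tD k E (Finsupp.single S 1) = ∑ s ∈ S, tsg s S • tw k E (tU E S) (S.erase s) := by
  simp [tD]

lemma smul_tw (E : Fin n → Finset V) {a b : V →₀ ℕ} {S : Finset (Fin n)}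
    (hab : a ≤ b) (hS : tU E S ≤ a) :
    (monomial (b - a) (1 : k)) • tw k E a S = tw k E b S := by
  rw [tw, tw, Finsupp.smul_single, smul_eq_mul, monomial_mul, one_mul]
  congr 2
  congr 1
  ext v
  have h1 := hab v
  have h2 := hS v
  simp only [Finsupp.add_apply, Finsupp.tsub_apply]
  omega

lemma tw_self (E : Fin n → Finset V) (S : Finset (Fin n)) :
    tw k E (tU E S) S = Finsupp.single S 1 := by
  simp [tw]

lemma tD_tw (E : Fin n → Finset V) {a : V →₀ ℕ} {S : Finset (Fin n)} (h : tU E S ≤ a) :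
    tD k E (tw k E a S) = ∑ s ∈ S, tsg s S • tw k E a (S.erase s) := by
  rw [← smul_tw E h le_rfl, map_smul, tw_self, tD_single, Finset.smul_sum]
  refine Finset.sum_congr rfl fun s _ => ?_
  rw [smul_comm, smul_tw E h (tU_mono E (Finset.erase_subset _ _))]

lemma tsg_swap_lt {s t : Fin n} {S : Finset (Fin n)} (hs : s ∈ S) (h : s < t) :
    tsg s S * tsg t (S.erase s) + tsg t S * tsg s (S.erase t) = 0 := by
  have e1 : (S.erase t).filter (· < s) = S.filter (· < s) := by
    ext x
    simp only [Finset.mem_filter, Finset.mem_erase]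
    constructor
    · rintro ⟨⟨-, h1⟩, h2⟩; exact ⟨h1, h2⟩
    · rintro ⟨h1, h2⟩; exact ⟨⟨(h2.trans h).ne, h1⟩, h2⟩
  have e2 : S.filter (· < t) = insert s ((S.erase s).filter (· < t)) := by
    ext x
    simp only [Finset.mem_filter, Finset.mem_erase, Finset.mem_insert]
    by_cases hx : x = s
    · subst hx; simp [hs, h]
    · simp [hx]
  have e3 : s ∉ (S.erase s).filter (· < t) := by simp
  unfold tsg
  rw [e1, e2, Finset.card_insert_of_notMem e3, pow_succ]
  ring

lemma tsg_swap {s t : Fin n} {S : Finset (Fin n)} (hs : s ∈ S) (ht : t ∈ S) (h : s ≠ t) :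
    tsg s S * tsg t (S.erase s) + tsg t S * tsg s (S.erase t) = 0 := by
  rcases lt_or_gt_of_ne h with h | h
  · exact tsg_swap_lt hs h
  · rw [add_comm]; exact tsg_swap_lt ht h

lemma tD_tD (E : Fin n → Finset V) (x : Finset (Fin n) →₀ MvPolynomial V k) :
    tD k E (tD k E x) = 0 := by
  have : tD k E ∘ₗ tD k E = 0 := by
    refine Finsupp.lhom_ext' fun S => LinearMap.ext_ring ?_
    simp only [LinearMap.comp_apply, Finsupp.lsingle_apply, LinearMap.zero_apply]
    rw [tD_single, map_sum]
    have e : ∀ s ∈ S, tD k E (tsg s S • tw k E (tU E S) (S.erase s)) =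
        ∑ t ∈ S.erase s, (tsg s S * tsg t (S.erase s)) •
          tw k E (tU E S) ((S.erase s).erase t) := by
      intro s _
      rw [map_zsmul, tD_tw E (tU_mono E (Finset.erase_subset _ _)), Finset.smul_sum]
      exact Finset.sum_congr rfl fun t _ => by rw [mul_smul]
    rw [Finset.sum_congr rfl e, Finset.sum_sigma']
    refine Finset.sum_involution (fun p _ => ⟨p.2, p.1⟩) ?_ ?_ ?_ ?_
    · rintro ⟨s, t⟩ h
      simp only [Finset.mem_sigma, Finset.mem_erase] at h
      simp only
      rw [Finset.erase_right_comm (a := t), ← add_smul, tsg_swap h.1 h.2.2 (Ne.symm h.2.1),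
        zero_smul]
    · rintro ⟨s, t⟩ h _ heq
      simp only [Finset.mem_sigma, Finset.mem_erase] at h
      simp only [Sigma.mk.injEq] at heq
      exact h.2.1 heq.1
    · rintro ⟨s, t⟩ h
      simp only [Finset.mem_sigma, Finset.mem_erase] at h ⊢
      exact ⟨h.2.2, Ne.symm h.2.1, h.1⟩
    · rintro ⟨s, t⟩ h; rfl
  exact LinearMap.congr_fun this x

noncomputable def tF (E : Fin n → Finset V) (a : V →₀ ℕ) : Finset (Fin n) :=
  Finset.univ.filter fun s => tU E {s} ≤ a

noncomputable def tHval (k : Type) [Field k] (E : Fin n → Finset V) (a : V →₀ ℕ)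
    (S : Finset (Fin n)) : Finset (Fin n) →₀ MvPolynomial V k :=
  if h : (tF E a).Nonempty then
    (if (tF E a).min' h ∈ S then 0 else tw k E a (insert ((tF E a).min' h) S)) else 0

noncomputable def tH (k : Type) [Field k] (E : Fin n → Finset V) :
    (Finset (Fin n) →₀ MvPolynomial V k) →ₗ[k] (Finset (Fin n) →₀ MvPolynomial V k) :=
  Finsupp.lsum k fun S => (basisMonomials V k).constr k fun b => tHval k E (b + tU E S) S

lemma tH_single (E : Fin n → Finset V) (b : V →₀ ℕ) (S : Finset (Fin n)) :
    tH k E (Finsupp.single S (monomial b 1)) = tHval k E (b + tU E S) S := by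
  simp only [tH, Finsupp.lsum_single]
  have : (monomial b (1 : k)) = basisMonomials V k b := by simp
  rw [this, Module.Basis.constr_basis]

lemma tH_tw (E : Fin n → Finset V) {a : V →₀ ℕ} {S : Finset (Fin n)} (h : tU E S ≤ a) :
    tH k E (tw k E a S) = tHval k E a S := by
  rw [tw, tH_single, tsub_add_cancel_of_le h]

lemma t_homotopy_tw (E : Fin n → Finset V) {a : V →₀ ℕ} {S : Finset (Fin n)}
    (hS : S.Nonempty) (h : tU E S ≤ a) :
    tD k E (tH k E (tw k E a S)) + tH k E (tD k E (tw k E a S)) = tw k E a S := by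
  have hSF : S ⊆ tF E a := by
    intro s hs
    simp only [tF, Finset.mem_filter, Finset.mem_univ, true_and]
    exact (tU_mono E (by simpa using hs)).trans h
  have hne : (tF E a).Nonempty := hS.mono hSF
  set s0 := (tF E a).min' hne with hs0
  have hval : ∀ T, tHval k E a T = if s0 ∈ T then 0 else tw k E a (insert s0 T) := by
    intro T; rw [tHval, dif_pos hne]
  have hs0F : tU E {s0} ≤ a := by
    have := (tF E a).min'_mem hne
    simp only [tF, Finset.mem_filter] at this
    exact this.2
  have hmin : ∀ s ∈ S, s0 ≤ s := fun s hs => (tF E a).min'_le s (hSF hs)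
  have hle : ∀ s, tU E (S.erase s) ≤ a := fun s => (tU_mono E (Finset.erase_subset _ _)).trans h
  have hD : tH k E (tD k E (tw k E a S)) =
      ∑ s ∈ S, tsg s S • (if s0 ∈ S.erase s then 0 else tw k E a (insert s0 (S.erase s))) := by
    rw [tD_tw E h, map_sum]
    refine Finset.sum_congr rfl fun s _ => ?_
    rw [map_zsmul, tH_tw E (hle s), hval]
  have hsg0 : ∀ T : Finset (Fin n), (∀ s ∈ T, s0 ≤ s) → tsg s0 T = 1 := by
    intro T hT
    have : T.filter (· < s0) = ∅ := by
      apply Finset.filter_eq_empty_iff.2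
      intro x hx; exact not_lt.2 (hT x hx)
    rw [tsg, this]; simp
  rw [hD, tH_tw E h, hval]
  by_cases hmem : s0 ∈ S
  · rw [if_pos hmem, map_zero, zero_add, Finset.sum_eq_single s0]
    · rw [hsg0 S hmin, if_neg (by simp), Finset.insert_erase hmem, one_smul]
    · intro s hs hne
      rw [if_pos (Finset.mem_erase.2 ⟨hne.symm, hmem⟩), smul_zero]
    · intro h; exact absurd hmem h
  · rw [if_neg hmem]
    have hins : tU E (insert s0 S) ≤ a := by
      refine tU_le_of E fun s hs => ?_
      rcases Finset.mem_insert.1 hs with rfl | hs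
      · exact hs0F
      · exact (tU_mono E (by simpa using hs)).trans h
    rw [tD_tw E hins, Finset.sum_insert hmem, hsg0, Finset.erase_insert hmem, one_smul, add_assoc,
      ← Finset.sum_add_distrib, Finset.sum_eq_zero, add_zero]
    · intro s hs
      have hne : s0 ≠ s := fun h => hmem (h ▸ hs)
      have hlt : s0 < s := lt_of_le_of_ne (hmin s hs) hne
      rw [if_neg (fun h => hmem (Finset.mem_of_mem_erase h)),
        Finset.erase_insert_of_ne hne, ← add_smul]
      have : tsg s (insert s0 S) = - tsg s S := by
        unfold tsg
        rw [Finset.filter_insert, if_pos hlt, Finset.card_insert_of_notMem (by simp [hmem]),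
          pow_succ]
        ring
      rw [this, neg_add_cancel, zero_smul]
    · intro s hs
      rcases Finset.mem_insert.1 hs with rfl | hs
      · exact le_rfl
      · exact hmin s hs

abbrev tι (n i : ℕ) : Type := {S : Finset (Fin n) // S.card = i}

noncomputable def tJ (k V : Type) [Field k] (n i : ℕ) :
    (tι n i →₀ MvPolynomial V k) →ₗ[MvPolynomial V k] (Finset (Fin n) →₀ MvPolynomial V k) :=
  Finsupp.lmapDomain _ _ Subtype.val

noncomputable def tP (k V : Type) [Field k] (n i : ℕ) :
    (Finset (Fin n) →₀ MvPolynomial V k) →ₗ[MvPolynomial V k] (tι n i →₀ MvPolynomial V k) :=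
  Finsupp.lcomapDomain Subtype.val Subtype.val_injective

lemma tJ_single (i : ℕ) (S : tι n i) (c : MvPolynomial V k) :
    tJ k V n i (Finsupp.single S c) = Finsupp.single S.1 c := by
  simp [tJ]

lemma tP_apply (i : ℕ) (x : Finset (Fin n) →₀ MvPolynomial V k) (S : tι n i) :
    tP k V n i x S = x S.1 := rfl

lemma tP_tJ (i : ℕ) (x : tι n i →₀ MvPolynomial V k) : tP k V n i (tJ k V n i x) = x := by
  ext S : 1
  rw [tP_apply]
  exact Finsupp.mapDomain_apply Subtype.val_injective _ _

/-- supported in cardinality `i` -/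
lemma tJ_tP (i : ℕ) (x : Finset (Fin n) →₀ MvPolynomial V k)
    (h : ∀ S, x S ≠ 0 → S.card = i) : tJ k V n i (tP k V n i x) = x := by
  ext S : 1
  by_cases hS : S.card = i
  · have := Finsupp.mapDomain_apply Subtype.val_injective (tP k V n i x) (⟨S, hS⟩ : tι n i)
    exact this
  · have h0 : x S = 0 := by
      by_contra hh; exact hS (h S hh)
    rw [h0]
    refine Finsupp.mapDomain_of_notMem_range _ _ ?_
    rintro ⟨T, rfl⟩
    exact hS T.2

lemma tD_single_apply (E : Fin n → Finset V) {S T : Finset (Fin n)} {m : V →₀ ℕ}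
    (h : coeff m (tD k E (Finsupp.single S 1) T) ≠ 0) :
    ∃ s ∈ S, T = S.erase s ∧ m = tU E S - tU E T := by
  rw [tD_single, Finsupp.finsetSum_apply, coeff_sum] at h
  obtain ⟨s, hs, h1⟩ := Finset.exists_ne_zero_of_sum_ne_zero h
  refine ⟨s, hs, ?_⟩
  rw [Finsupp.smul_apply, tw, Finsupp.single_apply] at h1
  split_ifs at h1 with h2
  · refine ⟨h2.symm, ?_⟩
    subst h2
    by_contra hm
    apply h1
    rw [← Int.cast_smul_eq_zsmul k, coeff_smul, coeff_monomial, if_neg (Ne.symm hm), smul_zero]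
  · simp at h1

lemma card_of_tD_tJ (E : Fin n → Finset V) (i : ℕ) (x : tι n (i + 1) →₀ MvPolynomial V k)
    (T : Finset (Fin n)) (h : tD k E (tJ k V n (i + 1) x) T ≠ 0) : T.card = i := by
  have e := map_eq_sum (tD k E ∘ₗ tJ k V n (i + 1)) x T
  rw [LinearMap.comp_apply] at e
  rw [e] at h
  obtain ⟨S, -, h1⟩ := Finset.exists_ne_zero_of_sum_ne_zero h
  have h2 := right_ne_zero_of_mul h1
  rw [LinearMap.comp_apply, tJ_single] at h2
  obtain ⟨m, hm⟩ := MvPolynomial.ne_zero_iff.1 h2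
  obtain ⟨s, hs, rfl, -⟩ := tD_single_apply E hm
  rw [Finset.card_erase_of_mem hs, S.2]; rfl

lemma card_of_tH_tJ (E : Fin n → Finset V) (i : ℕ) (x : tι n i →₀ MvPolynomial V k)
    (T : Finset (Fin n)) (h : tH k E (tJ k V n i x) T ≠ 0) : T.card = i + 1 := by
  induction x using Finsupp.induction_linear with
  | zero => simp at h
  | add x y hx hy =>
    by_cases h1 : tH k E (tJ k V n i x) T = 0
    · apply hy
      simpa [h1] using h
    · exact hx h1
  | single S c =>
    induction c using MvPolynomial.induction_on' with
    | add p q hp hq =>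
      rw [Finsupp.single_add] at h
      by_cases h1 : tH k E (tJ k V n i (Finsupp.single S p)) T = 0
      · apply hq
        simpa [h1] using h
      · exact hp h1
    | monomial b c =>
      have e : (monomial b c : MvPolynomial V k) = c • monomial b 1 := by
        rw [smul_monomial, smul_eq_mul, mul_one]
      rw [tJ_single, e, ← Finsupp.smul_single, map_smul, tH_single, Finsupp.smul_apply] at h
      have h2 := right_ne_zero_of_smul h
      rw [tHval] at h2
      split_ifs at h2 with h3 h4
      · simp at h2
      · rw [tw, Finsupp.single_apply] at h2
        split_ifs at h2 with h5
        · rw [← h5, Finset.card_insert_of_notMem h4, S.2]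
        · simp at h2
      · simp at h2

lemma t_homotopy (E : Fin n → Finset V) (i : ℕ) (x : tι n (i + 1) →₀ MvPolynomial V k) :
    tD k E (tH k E (tJ k V n (i + 1) x)) + tH k E (tD k E (tJ k V n (i + 1) x)) =
      tJ k V n (i + 1) x := by
  induction x using Finsupp.induction_linear with
  | zero => simp
  | add x y hx hy =>
    simp only [map_add]
    conv_rhs => rw [← hx, ← hy]
    abel
  | single S c =>
    induction c using MvPolynomial.induction_on' with
    | add p q hp hq =>
      simp only [Finsupp.single_add, map_add]
      conv_rhs => rw [← hp, ← hq]
      abel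
    | monomial b c =>
      have e : (Finsupp.single S.1 (monomial b c) : Finset (Fin n) →₀ MvPolynomial V k)
          = c • tw k E (b + tU E S.1) S.1 := by
        rw [tw, Finsupp.smul_single, smul_monomial, smul_eq_mul, mul_one, add_tsub_cancel_right]
      have hne : S.1.Nonempty := Finset.card_pos.1 (by rw [S.2]; omega)
      have hh := t_homotopy_tw (k := k) E hne (a := b + tU E S.1) le_add_self
      have hc : ∀ y, tD k E (c • y) = c • tD k E y := by
        intro y
        exact LinearMap.map_smul_of_tower (tD k E) c y
      rw [tJ_single, e, map_smul, hc, hc, map_smul, ← smul_add, hh]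

lemma tU_single_monomial (E : Fin n → Finset V) (s : Fin n) :
    monomial (tU E {s}) (1 : k) = ∏ v ∈ E s, X v := by
  rw [tU, Finset.singleton_biUnion, monomial_sum_one]; rfl

noncomputable def taylor (k : Type) [Field k] (E : Fin n → Finset V)
    (hE : ∀ s, ∃ v ∈ E s, ∀ t, t ≠ s → v ∉ E t) : GRes k V (edgeIdeal k E) where
  ι := tι n
  deg i S := (S.1.biUnion E).card
  d i := tP k V n i ∘ₗ tD k E ∘ₗ tJ k V n (i + 1)
  pt := ⟨∅, rfl⟩
  pt_uniq := fun p => Subtype.ext (Finset.card_eq_zero.1 p.2)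
  deg_pt := by simp
  range_zero := by
    intro y
    constructor
    · rintro ⟨x, rfl⟩
      rw [map_eq_sum]
      refine Ideal.sum_mem _ fun S _ => Ideal.mul_mem_left _ _ ?_
      obtain ⟨s, hs⟩ := Finset.card_eq_one.1 S.2
      rw [LinearMap.comp_apply, LinearMap.comp_apply, tP_apply, tJ_single, hs, tD_single,
        Finset.sum_singleton, Finsupp.smul_apply, tw]
      refine zsmul_mem ?_ _
      have : ({s} : Finset (Fin n)).erase s = ∅ := by simp
      rw [this, Finsupp.single_eq_same]
      have h0 : tU E ∅ = 0 := by simp [tU]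
      rw [h0, tsub_zero, tU_single_monomial]
      exact Ideal.subset_span ⟨s, rfl⟩
    · intro hy
      have key : edgeIdeal k E ≤ Submodule.comap (Finsupp.lsingle (⟨∅, rfl⟩ : tι n 0))
          (LinearMap.range (tP k V n 0 ∘ₗ tD k E ∘ₗ tJ k V n (0 + 1))) := by
        refine Ideal.span_le.2 ?_
        rintro _ ⟨s, rfl⟩
        refine ⟨Finsupp.single ⟨{s}, rfl⟩ 1, ?_⟩
        ext T : 1
        have hT : T = (⟨∅, rfl⟩ : tι n 0) := Subtype.ext (Finset.card_eq_zero.1 T.2)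
        subst hT
        rw [LinearMap.comp_apply, LinearMap.comp_apply, tP_apply, tJ_single, tD_single,
          Finset.sum_singleton, Finsupp.smul_apply, tw]
        have : ({s} : Finset (Fin n)).erase s = ∅ := by simp
        have h0 : tU E ∅ = 0 := by simp [tU]
        rw [this, Finsupp.single_eq_same, h0, tsub_zero, tU_single_monomial]
        simp [tsg, Finset.filter_singleton]
      have := key hy
      rw [Submodule.mem_comap] at this
      obtain ⟨x, hx⟩ := this
      refine ⟨x, ?_⟩
      rw [hx]
      ext T : 1
      have hT : T = (⟨∅, rfl⟩ : tι n 0) := Subtype.ext (Finset.card_eq_zero.1 T.2)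
      subst hT
      simp
  exact_succ := by
    intro i y
    simp only [LinearMap.comp_apply]
    constructor
    · intro h
      have h1 : tD k E (tJ k V n (i + 1) y) = 0 := by
        rw [← tJ_tP i _ (card_of_tD_tJ E i y), h, map_zero]
      refine ⟨tP k V n (i + 2) (tH k E (tJ k V n (i + 1) y)), ?_⟩
      rw [tJ_tP _ _ (card_of_tH_tJ E (i + 1) y)]
      have h2 := t_homotopy E i y
      rw [h1, map_zero, add_zero] at h2
      rw [h2, tP_tJ]
    · rintro ⟨x, rfl⟩
      rw [tJ_tP _ _ (card_of_tD_tJ E (i + 1) x), tD_tD, map_zero]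
  minimal := by
    intro i x p
    rw [map_eq_sum, map_sum]
    refine Finset.sum_eq_zero fun q _ => ?_
    rw [map_mul]
    convert mul_zero _
    by_contra h
    rw [LinearMap.comp_apply, LinearMap.comp_apply, tP_apply, tJ_single] at h
    obtain ⟨s, hs, hp, hm⟩ := tD_single_apply E (m := 0) h
    obtain ⟨v, hv, hv'⟩ := hE s
    have := DFunLike.congr_fun hm v
    rw [Finsupp.tsub_apply, tU_apply, tU_apply, if_pos (Finset.mem_biUnion.2 ⟨s, hs, hv⟩),
      if_neg] at this
    · simp at this
    · rw [hp]
      intro h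
      obtain ⟨t, ht, hvt⟩ := Finset.mem_biUnion.1 h
      exact hv' t (Finset.ne_of_mem_erase ht) hvt
  graded := by
    intro i q p m h
    rw [LinearMap.comp_apply, LinearMap.comp_apply, tP_apply, tJ_single] at h
    obtain ⟨s, hs, hp, hm⟩ := tD_single_apply E h
    rw [hm, ← tU_degree, ← tU_degree, ← map_add, tsub_add_cancel_of_le]
    rw [hp]; exact tU_mono E (Finset.erase_subset _ _)

noncomputable def toGRes {I : Ideal (MvPolynomial V k)} (F : MinimalGradedFreeResolution k V I) :
    GRes k V I where
  ι i := Σ j : ℕ, Fin (F.β i j)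
  deg i p := p.1
  d := F.d
  pt := ⟨0, ⟨0, by rw [F.β_zero]; simp⟩⟩
  pt_uniq := by
    rintro ⟨j, t⟩
    have ht := lt_of_lt_of_eq t.2 (F.β_zero j)
    split_ifs at ht with h
    · subst h
      congr 1
      apply Fin.ext
      simp only
      omega
    · omega
  deg_pt := rfl
  range_zero := by
    set pt : (Σ j : ℕ, Fin (F.β 0 j)) := ⟨0, ⟨0, by rw [F.β_zero]; simp⟩⟩ with hpt
    have huniq : ∀ p, p = pt := by
      rintro ⟨j, t⟩
      have ht := lt_of_lt_of_eq t.2 (F.β_zero j)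
      split_ifs at ht with h
      · subst h
        rw [hpt]
        congr 1
        apply Fin.ext
        simp only
        omega
      · omega
    have hs : ∀ x : (Σ j : ℕ, Fin (F.β 0 j)) →₀ MvPolynomial V k,
        x = (x pt) • Finsupp.single pt 1 := by
      intro x; ext p : 1; rw [huniq p]; simp
    have haug : ∀ x, F.aug x = x pt • F.aug (Finsupp.single pt 1) := by
      intro x
      conv_lhs => rw [hs x, map_smul]
    obtain ⟨x1, hx1⟩ := F.aug_surjective 1
    rw [haug] at hx1
    have hsm : ∀ (a : MvPolynomial V k) (z : MvPolynomial V k ⧸ I),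
        a • z = Ideal.Quotient.mk I a * z := by
      intro a z
      obtain ⟨b, rfl⟩ := Ideal.Quotient.mk_surjective z
      rfl
    intro y
    have h1 : (∃ x, F.d 0 x = y) ↔ F.aug y = 0 := by
      rw [← LinearMap.mem_ker, F.exact_zero]; rfl
    rw [h1, haug]
    have h2 : (Ideal.Quotient.mk I (y pt)) = x1 pt • (y pt • F.aug (Finsupp.single pt 1)) := by
      rw [smul_comm, hx1, hsm, mul_one]
    constructor
    · intro h
      rw [h, smul_zero] at h2
      exact Ideal.Quotient.eq_zero_iff_mem.1 h2
    · intro h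
      have h3 := Ideal.Quotient.eq_zero_iff_mem.2 h
      rw [hsm, h3, zero_mul]
  exact_succ := by
    intro i y
    rw [← LinearMap.mem_ker, F.exact_succ]; rfl
  minimal := F.minimal
  graded := by
    rintro i ⟨j, t⟩ p m h
    obtain ⟨h1, h2⟩ := F.graded i j t p
    have h3 : m.degree = j - p.1 := by
      have := h1 h
      rw [Finsupp.degree_eq_weight_one]; exact this
    rcases h2 with h2 | h2
    · simp only
      omega
    · rw [h2] at h; simp at h

lemma beta_eq_card (E : Fin n → Finset V)
    (hE : ∀ s, ∃ v ∈ E s, ∀ t, t ≠ s → v ∉ E t)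
    (F : MinimalGradedFreeResolution k V (edgeIdeal k E)) (i j : ℕ) :
    F.β i j = ((Finset.univ : Finset (Finset (Fin n))).filter
      fun S => S.card = i ∧ (S.biUnion E).card = j).card := by
  let e1 : {p : (toGRes F).ι i // (toGRes F).deg i p = j} ≃ Fin (F.β i j) :=
    { toFun := fun p => ⟨p.1.2.1, lt_of_lt_of_eq p.1.2.2 (congrArg (F.β i) p.2)⟩
      invFun := fun t => ⟨⟨j, t⟩, rfl⟩
      left_inv := by rintro ⟨⟨j', t⟩, h⟩; change j' = j at h; subst h; rfl
      right_inv := fun t => rfl }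
  have f1 : Finite {p : (toGRes F).ι i // (toGRes F).deg i p = j} := Finite.of_equiv _ e1.symm
  have f2 : Finite {p : (taylor k E hE).ι i // (taylor k E hE).deg i p = j} :=
    inferInstanceAs (Finite {p : tι n i // (p.1.biUnion E).card = j})
  have h := le_antisymm (card_le (toGRes F) (taylor k E hE) i j)
    (card_le (taylor k E hE) (toGRes F) i j)
  rw [Nat.card_congr e1, Nat.card_fin] at h
  rw [h]
  have e2 : {p : (taylor k E hE).ι i // (taylor k E hE).deg i p = j} ≃
      {S : Finset (Fin n) // S.card = i ∧ (S.biUnion E).card = j} :=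
    Equiv.subtypeSubtypeEquivSubtypeInter (fun S : Finset (Fin n) => S.card = i)
      (fun S => (S.biUnion E).card = j)
  rw [Nat.card_congr e2, Nat.card_eq_fintype_card, Fintype.card_subtype]

end taylor

section count

def ladj (T : Finset ℕ) : ℕ := (T.filter fun t => t + 1 ∈ T).card

lemma ladj_lt {T : Finset ℕ} (h : T.Nonempty) : ladj T < T.card := by
  refine Finset.card_lt_card ⟨Finset.filter_subset _ _, fun hh => ?_⟩
  have h1 := Finset.mem_filter.1 (hh (T.max'_mem h))
  have := T.le_max' _ h1.2
  omega

def LS (m i r : ℕ) (b : Prop) [Decidable b] : Finset (Finset ℕ) :=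
  (Finset.range (m + 1)).powerset.filter
    fun T => 0 ∉ T ∧ T.card = i ∧ ladj T + r = i ∧ (m ∈ T ↔ b)

lemma mem_LS {m i r : ℕ} {b : Prop} [Decidable b] {T : Finset ℕ} :
    T ∈ LS m i r b ↔ (∀ t ∈ T, t ≤ m) ∧ 0 ∉ T ∧ T.card = i ∧ ladj T + r = i ∧ (m ∈ T ↔ b) := by
  simp only [LS, Finset.mem_filter, Finset.mem_powerset]
  refine and_congr_left fun _ => ?_
  constructor
  · intro h t ht
    have := Finset.mem_range.1 (h ht); omega
  · intro h t ht
    have := h t ht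
    exact Finset.mem_range.2 (by omega)

lemma ladj_insert {m : ℕ} {T : Finset ℕ} (h : ∀ t ∈ T, t ≤ m) :
    ladj (insert (m + 1) T) = ladj T + if m ∈ T then 1 else 0 := by
  have e : (insert (m + 1) T).filter (fun t => t + 1 ∈ insert (m + 1) T) =
      T.filter (fun t => t + 1 ∈ T) ∪ T.filter (fun t => t = m) := by
    ext t
    simp only [Finset.mem_filter, Finset.mem_insert, Finset.mem_union]
    constructor
    · rintro ⟨rfl | h1, h2 | h2⟩
      · omega
      · have := h _ h2; omega
      · right; exact ⟨h1, by omega⟩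
      · left; exact ⟨h1, h2⟩
    · rintro (⟨h1, h2⟩ | ⟨h1, h2⟩)
      · exact ⟨Or.inr h1, Or.inr h2⟩
      · exact ⟨Or.inr h1, Or.inl (by omega)⟩
  unfold ladj
  rw [e, Finset.card_union_of_disjoint]
  · congr 1
    split_ifs with hm
    · rw [Finset.filter_eq' T m, if_pos hm, Finset.card_singleton]
    · rw [Finset.filter_eq' T m, if_neg hm, Finset.card_empty]
  · rw [Finset.disjoint_left]
    intro t h1 h2
    simp only [Finset.mem_filter] at h1 h2
    have := h _ h1.2
    omega

lemma LS_false_succ (m i r : ℕ) :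
    (LS (m + 1) i r False).card = (LS m i r False).card + (LS m i r True).card := by
  rw [← Finset.card_union_of_disjoint]
  · congr 1
    ext T
    simp only [Finset.mem_union, mem_LS, iff_false, iff_true]
    constructor
    · rintro ⟨h1, h2, h3, h4, h5⟩
      have : ∀ t ∈ T, t ≤ m := by
        intro t ht
        have := h1 t ht
        have : t ≠ m + 1 := fun h => h5 (h ▸ ht)
        omega
      by_cases hm : m ∈ T
      · right; exact ⟨this, h2, h3, h4, hm⟩
      · left; exact ⟨this, h2, h3, h4, hm⟩
    · have key : (∀ t ∈ T, t ≤ m) → (∀ t ∈ T, t ≤ m + 1) ∧ m + 1 ∉ T := by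
        intro h
        exact ⟨fun t ht => by have := h t ht; omega, fun ht => by have := h _ ht; omega⟩
      rintro (⟨h1, h2, h3, h4, h5⟩ | ⟨h1, h2, h3, h4, h5⟩)
      · exact ⟨(key h1).1, h2, h3, h4, (key h1).2⟩
      · exact ⟨(key h1).1, h2, h3, h4, (key h1).2⟩
  · rw [Finset.disjoint_left]
    intro T h1 h2
    simp only [mem_LS, iff_false, iff_true] at h1 h2
    exact h1.2.2.2.2 h2.2.2.2.2

lemma LS_true_succ (m i r : ℕ) :
    (LS (m + 1) (i + 1) (r + 1) True).card =
      (LS m i (r + 1) True).card + (LS m i r False).card := by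
  rw [← Finset.card_union_of_disjoint]
  · symm
    refine Finset.card_nbij' (fun T => insert (m + 1) T) (fun T => T.erase (m + 1)) ?_ ?_ ?_ ?_
    · intro T hT
      simp only [Finset.coe_union, Set.mem_union, Finset.mem_coe, mem_LS, iff_true,
        iff_false] at hT
      have hle : ∀ t ∈ T, t ≤ m := by rcases hT with h | h <;> exact h.1
      have h0 : 0 ∉ T := by rcases hT with h | h <;> exact h.2.1
      have hc : T.card = i := by rcases hT with h | h <;> exact h.2.2.1
      have hm : m + 1 ∉ T := fun h => by have := hle _ h; omega
      simp only [Finset.mem_coe, mem_LS, iff_true]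
      refine ⟨?_, ?_, ?_, ?_, Finset.mem_insert_self _ _⟩
      · intro t ht
        rcases Finset.mem_insert.1 ht with rfl | ht
        · exact le_rfl
        · have := hle _ ht; omega
      · simp [h0]
      · rw [Finset.card_insert_of_notMem hm, hc]
      · rw [ladj_insert hle]
        rcases hT with h | h
        · rw [if_pos h.2.2.2.2]; have := h.2.2.2.1; omega
        · rw [if_neg h.2.2.2.2]; have := h.2.2.2.1; omega
    · intro T hT
      simp only [Finset.mem_coe, mem_LS, iff_true] at hT
      obtain ⟨h1, h2, h3, h4, h5⟩ := hT
      simp only [Finset.coe_union, Set.mem_union, Finset.mem_coe, mem_LS, iff_true,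
        iff_false]
      have hle : ∀ t ∈ T.erase (m + 1), t ≤ m := by
        intro t ht
        have a := Finset.mem_erase.1 ht
        have := h1 t a.2
        omega
      have h0 : 0 ∉ T.erase (m + 1) := fun h => h2 (Finset.mem_of_mem_erase h)
      have hc : (T.erase (m + 1)).card = i := by
        rw [Finset.card_erase_of_mem h5, h3]; rfl
      have hl := ladj_insert hle
      rw [Finset.insert_erase h5] at hl
      by_cases hm : m ∈ T.erase (m + 1)
      · left
        rw [if_pos hm] at hl
        exact ⟨hle, h0, hc, by omega, hm⟩
      · right
        rw [if_neg hm] at hl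
        exact ⟨hle, h0, hc, by omega, hm⟩
    · intro T hT
      simp only [Finset.coe_union, Set.mem_union, Finset.mem_coe, mem_LS, iff_true,
        iff_false] at hT
      have hle : ∀ t ∈ T, t ≤ m := by rcases hT with h | h <;> exact h.1
      have hm : m + 1 ∉ T := fun h => by have := hle _ h; omega
      exact Finset.erase_insert hm
    · intro T hT
      simp only [Finset.mem_coe, mem_LS, iff_true] at hT
      exact Finset.insert_erase hT.2.2.2.2
  · rw [Finset.disjoint_left]
    intro T h1 h2
    simp only [mem_LS, iff_false, iff_true] at h1 h2
    exact h2.2.2.2.2 h1.2.2.2.2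

lemma LS_true_zero (m r : ℕ) : (LS m 0 r True).card = 0 := by
  rw [Finset.card_eq_zero, Finset.eq_empty_iff_forall_notMem]
  intro T hT
  simp only [mem_LS, iff_true] at hT
  have := Finset.card_eq_zero.1 hT.2.2.1
  subst this
  simp at hT

lemma LS_false_zero (m r : ℕ) : (LS m 0 r False).card = if r = 0 then 1 else 0 := by
  split_ifs with h
  · subst h
    rw [Finset.card_eq_one]
    refine ⟨∅, ?_⟩
    ext T
    simp only [mem_LS, iff_false, Finset.mem_singleton]
    constructor
    · intro h; exact Finset.card_eq_zero.1 h.2.2.1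
    · rintro rfl; simp [ladj]
  · rw [Finset.card_eq_zero, Finset.eq_empty_iff_forall_notMem]
    intro T hT
    have := (mem_LS.1 hT).2.2.2.1
    omega

lemma LS_succ_zero (m i : ℕ) (b : Prop) [Decidable b] : (LS m (i + 1) 0 b).card = 0 := by
  rw [Finset.card_eq_zero, Finset.eq_empty_iff_forall_notMem]
  intro T hT
  have h := mem_LS.1 hT
  have h1 := h.2.2.1
  have h2 := h.2.2.2.1
  have := ladj_lt (T := T) (Finset.card_pos.1 (by omega))
  omega

lemma LS_base (i r : ℕ) (b : Prop) [Decidable b] : (LS 0 (i + 1) r b).card = 0 := by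
  rw [Finset.card_eq_zero, Finset.eq_empty_iff_forall_notMem]
  intro T hT
  have h := mem_LS.1 hT
  have : T = ∅ := by
    rw [Finset.eq_empty_iff_forall_notMem]
    intro t ht
    have h1 := h.1 t ht
    have : t = 0 := by omega
    exact h.2.1 (this ▸ ht)
  have h3 := h.2.2.1
  rw [this] at h3
  simp at h3

lemma LS_closed (m : ℕ) :
    (∀ i r, (LS m (i + 1) (r + 1) True).card =
      if i + 1 ≤ m then i.choose r * (m - i - 1).choose r else 0) ∧
    (∀ i r, (LS m (i + 1) (r + 1) False).card = i.choose r * (m - i - 1).choose (r + 1)) := by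
  induction m with
  | zero =>
    refine ⟨fun i r => ?_, fun i r => ?_⟩
    · rw [LS_base]; simp
    · rw [LS_base]; simp
  | succ m ih =>
    obtain ⟨ih1, ih0⟩ := ih
    refine ⟨fun i r => ?_, fun i r => ?_⟩
    · rw [LS_true_succ]
      rcases i with _ | i
      · rw [LS_true_zero, LS_false_zero]
        rcases r with _ | r
        · simp
        · simp
      · rw [ih1]
        rcases r with _ | r
        · rw [LS_succ_zero]
          simp
        · rw [ih0]
          have e : m + 1 - (i + 1) - 1 = m - i - 1 := by omega
          rw [e]
          by_cases h : i + 1 ≤ m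
          · rw [if_pos h, if_pos (by omega), Nat.choose_succ_succ i r]; ring
          · rw [if_neg h, if_neg (by omega)]
            have : m - i - 1 = 0 := by omega
            rw [this]; simp
    · rw [LS_false_succ, ih1, ih0]
      by_cases h : i + 1 ≤ m
      · rw [if_pos h]
        have e : m + 1 - i - 1 = (m - i - 1) + 1 := by omega
        rw [e, Nat.choose_succ_succ]; ring
      · rw [if_neg h]
        have : m - i - 1 = 0 := by omega
        have e : m + 1 - i - 1 = 0 := by omega
        rw [this, e, add_zero]

/-- cyclic adjacencies -/
def cadj {m : ℕ} (S : Finset (Fin (m + 1))) : ℕ := (S.filter fun s => s + 1 ∈ S).card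

lemma closed_univ {m : ℕ} {S : Finset (Fin (m + 1))} (hS : S.Nonempty)
    (h : ∀ s ∈ S, s + 1 ∈ S) : S = Finset.univ := by
  obtain ⟨s, hs⟩ := hS
  have key : ∀ c : ℕ, ∀ hc : c < m + 1, s + (⟨c, hc⟩ : Fin (m + 1)) ∈ S := by
    intro c
    induction c with
    | zero =>
      intro hc
      have : (⟨0, hc⟩ : Fin (m + 1)) = 0 := rfl
      rw [this, add_zero]; exact hs
    | succ c ih =>
      intro hc
      have := h _ (ih (by omega))
      rw [add_assoc] at this
      convert this using 2
      apply Fin.ext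
      rw [Fin.val_add_one, if_neg]
      intro h
      have := congrArg Fin.val h
      simp at this
      omega
  refine Finset.eq_univ_of_forall fun t => ?_
  have := key (t - s).val (t - s).2
  simpa using this

lemma cadj_lt {m : ℕ} {S : Finset (Fin (m + 1))} (hS : S.Nonempty) (hc : S.card < m + 1) :
    cadj S < S.card := by
  refine Finset.card_lt_card ⟨Finset.filter_subset _ _, fun hh => ?_⟩
  have := closed_univ hS fun s hs => (Finset.mem_filter.1 (hh hs)).2
  rw [this] at hc
  simp at hc

lemma cadj_map {m : ℕ} (S : Finset (Fin (m + 1))) (c : Fin (m + 1)) :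
    cadj (S.map (Equiv.addRight c).toEmbedding) = cadj S := by
  unfold cadj
  rw [Finset.filter_map, Finset.card_map]
  congr 1
  ext s
  simp only [Finset.mem_filter, Function.comp, Finset.mem_map_equiv]
  refine and_congr_right fun _ => ?_
  have : (Equiv.addRight c).symm ((Equiv.addRight c).toEmbedding s + 1) = s + 1 := by
    rw [Equiv.symm_apply_eq]
    simp only [Equiv.coe_toEmbedding, Equiv.coe_addRight]
    abel
  rw [this]

def CS (m i r : ℕ) : Finset (Finset (Fin (m + 1))) :=
  Finset.univ.filter fun S => S.card = i ∧ cadj S + r = i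

lemma CS_fiber (m i r : ℕ) (s : Fin (m + 1)) :
    ((CS m i r).filter fun S => s ∈ S ∧ s + 1 ∉ S).card =
      ((CS m i r).filter fun S => Fin.last m ∈ S ∧ 0 ∉ S).card := by
  refine Finset.card_equiv (Equiv.addRight (-(s + 1))).finsetCongr fun S => ?_
  simp only [CS, Finset.mem_filter, Finset.mem_univ, true_and, Equiv.finsetCongr_apply,
    Finset.card_map, cadj_map, Finset.mem_map_equiv]
  have e1 : (Equiv.addRight (-(s + 1))).symm (Fin.last m) = s := by
    rw [Equiv.symm_apply_eq]
    simp only [Equiv.coe_addRight]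
    have : Fin.last m = -1 := by
      rw [eq_neg_iff_add_eq_zero]; simp
    rw [this]; abel
  have e2 : (Equiv.addRight (-(s + 1))).symm 0 = s + 1 := by
    rw [Equiv.symm_apply_eq]
    simp
  rw [e1, e2]

lemma ladj_map {m : ℕ} (S : Finset (Fin (m + 1))) (h0 : 0 ∉ S) :
    ladj (S.map Fin.valEmbedding) = cadj S := by
  unfold ladj cadj
  rw [Finset.filter_map, Finset.card_map]
  congr 1
  ext s
  simp only [Finset.mem_filter, Function.comp, Finset.mem_map, Fin.valEmbedding_apply]
  refine and_congr_right fun hs => ?_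
  constructor
  · rintro ⟨t, ht, e⟩
    have : s + 1 = t := by
      apply Fin.ext
      rw [Fin.val_add_one, e, if_neg]
      rintro rfl
      have := t.2
      simp at e
      omega
    rwa [this]
  · intro h
    refine ⟨s + 1, h, ?_⟩
    rw [Fin.val_add_one, if_neg]
    rintro rfl
    simp at h
    exact h0 h

lemma CS_last (m i r : ℕ) :
    ((CS m i r).filter fun S => Fin.last m ∈ S ∧ 0 ∉ S).card = (LS m i r True).card := by
  refine Finset.card_bij (fun S _ => S.map Fin.valEmbedding) ?_ ?_ ?_
  · intro S hS
    simp only [CS, Finset.mem_filter, Finset.mem_univ, true_and] at hS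
    obtain ⟨⟨h1, h2⟩, h3, h4⟩ := hS
    rw [mem_LS]
    refine ⟨?_, ?_, ?_, ?_, ?_⟩
    · intro t ht
      obtain ⟨s, -, rfl⟩ := Finset.mem_map.1 ht
      have := s.2
      simp only [Fin.valEmbedding_apply]
      omega
    · intro ht
      obtain ⟨s, hs, e⟩ := Finset.mem_map.1 ht
      have : s = 0 := Fin.ext e
      exact h4 (this ▸ hs)
    · rw [Finset.card_map, h1]
    · rw [ladj_map S h4, h2]
    · rw [iff_true]
      exact Finset.mem_map.2 ⟨Fin.last m, h3, rfl⟩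
  · intro S _ S' _ h
    exact Finset.map_injective _ h
  · intro T hT
    obtain ⟨h1, h2, h3, h4, h5⟩ := mem_LS.1 hT
    have e : (Finset.univ.filter fun s : Fin (m + 1) => s.val ∈ T).map Fin.valEmbedding = T := by
      ext t
      simp only [Finset.mem_map, Finset.mem_filter, Finset.mem_univ, true_and,
        Fin.valEmbedding_apply]
      constructor
      · rintro ⟨s, hs, rfl⟩; exact hs
      · intro ht
        exact ⟨⟨t, by have := h1 t ht; omega⟩, ht, rfl⟩
    have h0 : (0 : Fin (m + 1)) ∉ Finset.univ.filter fun s : Fin (m + 1) => s.val ∈ T := by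
      simpa using h2
    refine ⟨_, ?_, e⟩
    simp only [CS, Finset.mem_filter, Finset.mem_univ, true_and]
    refine ⟨⟨?_, ?_⟩, ?_, ?_⟩
    · rw [← h3]; conv_rhs => rw [← e]
      rw [Finset.card_map]
    · rw [← ladj_map _ h0, e, h4]
    · simpa using h5
    · simpa using h2

lemma CS_card (m i r : ℕ) (hi : 1 ≤ i) (him : i ≤ m) (hr : 1 ≤ r) :
    r * (CS m i r).card = (m + 1) * ((i - 1).choose (r - 1) * (m - i).choose (r - 1)) := by
  have h := Finset.sum_card_bipartiteAbove_eq_sum_card_bipartiteBelow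
    (s := CS m i r) (t := (Finset.univ : Finset (Fin (m + 1))))
    (fun S s => s ∈ S ∧ s + 1 ∉ S)
  have h1 : ∀ S ∈ CS m i r, (Finset.bipartiteAbove (fun (S : Finset (Fin (m + 1))) s =>
      s ∈ S ∧ s + 1 ∉ S) Finset.univ S).card = r := by
    intro S hS
    simp only [CS, Finset.mem_filter, Finset.mem_univ, true_and] at hS
    have e : Finset.bipartiteAbove (fun (S : Finset (Fin (m + 1))) s =>
      s ∈ S ∧ s + 1 ∉ S) Finset.univ S = S.filter fun s => ¬ s + 1 ∈ S := by
      ext s; simp [Finset.bipartiteAbove]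
    have h2 := Finset.card_filter_add_card_filter_not (s := S) (fun s => s + 1 ∈ S)
    rw [e]
    have h3 := hS.2
    unfold cadj at h3
    omega
  have h2 : ∀ s ∈ (Finset.univ : Finset (Fin (m + 1))),
      (Finset.bipartiteBelow (fun (S : Finset (Fin (m + 1))) s =>
      s ∈ S ∧ s + 1 ∉ S) (CS m i r) s).card = (LS m i r True).card := by
    intro s _
    rw [← CS_last, ← CS_fiber m i r s]; rfl
  rw [Finset.sum_congr rfl h1, Finset.sum_congr rfl h2, Finset.sum_const, Finset.sum_const,
    Finset.card_univ, Fintype.card_fin, smul_eq_mul, smul_eq_mul] at h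
  obtain ⟨i, rfl⟩ : ∃ i', i = i' + 1 := ⟨i - 1, by omega⟩
  obtain ⟨r, rfl⟩ : ∃ r', r = r' + 1 := ⟨r - 1, by omega⟩
  rw [(LS_closed m).1, if_pos him] at h
  rw [mul_comm, h]
  congr 2

end count

section hyper

variable {V : Type} [DecidableEq V]

lemma val_succ_fin {m : ℕ} (hm : 1 ≤ m) (s : Fin (m + 1)) :
    (s + 1).val = (s.val + 1) % (m + 1) := by
  rw [Fin.val_add, Fin.val_one', Nat.mod_eq_of_lt (show 1 < m + 1 by omega)]

lemma hyper_adj {m d α : ℕ} {E : ℕ → Finset V} (hm : 1 ≤ m) (h : IsHypercycle (m + 1) d α E)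
    {s t : Fin (m + 1)} (hst : s ≠ t) {v : V} (hs : v ∈ E s.val) (ht : v ∈ E t.val) :
    t = s + 1 ∨ s = t + 1 := by
  have := (h.inter_nonempty_iff s.val s.2 t.val t.2 (fun e => hst (Fin.ext e))).1
    ⟨v, Finset.mem_inter.2 ⟨hs, ht⟩⟩
  rcases this with h1 | h1
  · left; apply Fin.ext; rw [val_succ_fin hm, h1]
  · right; apply Fin.ext; rw [val_succ_fin hm, h1]

lemma hyper_inter {m d α : ℕ} {E : ℕ → Finset V} (hm : 1 ≤ m) (h : IsHypercycle (m + 1) d α E)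
    (s : Fin (m + 1)) : (E s.val ∩ E (s + 1).val).card = α := by
  rw [val_succ_fin hm]; exact h.inter_card s.val s.2

lemma hyper_private {m d α : ℕ} {E : ℕ → Finset V} (hm : 1 ≤ m) (hd : 2 * α < d)
    (h : IsHypercycle (m + 1) d α E) (s : Fin (m + 1)) :
    ∃ v ∈ E s.val, ∀ t : Fin (m + 1), t ≠ s → v ∉ E t.val := by
  by_contra hcon
  push Not at hcon
  have hsub : E s.val ⊆ (E s.val ∩ E (s + 1).val) ∪ (E (s - 1).val ∩ E (s - 1 + 1).val) := by
    intro v hv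
    obtain ⟨t, hts, hvt⟩ := hcon v hv
    rw [Finset.mem_union, Finset.mem_inter, Finset.mem_inter]
    rcases hyper_adj hm h (Ne.symm hts) hv hvt with rfl | rfl
    · left; exact ⟨hv, hvt⟩
    · right
      rw [add_sub_cancel_right]
      exact ⟨hvt, hv⟩
  have h1 := (Finset.card_le_card hsub).trans (Finset.card_union_le _ _)
  rw [hyper_inter hm h, hyper_inter hm h, h.card_eq _ s.2] at h1
  omega

lemma hyper_union {m d α : ℕ} {E : ℕ → Finset V} (hm : 1 ≤ m)
    (h : IsHypercycle (m + 1) d α E) (S : Finset (Fin (m + 1))) (hS : S.card < m + 1) :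
    (S.biUnion fun s => E s.val).card + α * cadj S = S.card * d := by
  let A : Fin (m + 1) → Finset V :=
    fun s => if s + 1 ∈ S then E s.val \ E (s + 1).val else E s.val
  have hAsub : ∀ s, A s ⊆ E s.val := by
    intro s
    simp only [A]
    split_ifs
    · exact Finset.sdiff_subset
    · exact subset_rfl
  have hA : ∀ s v, s + 1 ∈ S → v ∈ A s → v ∉ E (s + 1).val := by
    intro s v hs hv
    simp only [A, if_pos hs] at hv
    exact (Finset.mem_sdiff.1 hv).2
  have hU : (S.biUnion fun s => E s.val) = S.biUnion A := by
    apply Finset.Subset.antisymm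
    · intro v hv
      obtain ⟨s, hs, hvs⟩ := Finset.mem_biUnion.1 hv
      by_contra hcon
      have hno : ∀ t ∈ S, v ∉ A t := fun t ht hvt => hcon (Finset.mem_biUnion.2 ⟨t, ht, hvt⟩)
      have hQ : S.filter (fun t => v ∈ E t.val) = Finset.univ := by
        refine closed_univ ⟨s, Finset.mem_filter.2 ⟨hs, hvs⟩⟩ fun t ht => ?_
        obtain ⟨ht1, ht2⟩ := Finset.mem_filter.1 ht
        have := hno t ht1
        simp only [A] at this
        split_ifs at this with h3
        · refine Finset.mem_filter.2 ⟨h3, ?_⟩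
          by_contra h4
          exact this (Finset.mem_sdiff.2 ⟨ht2, h4⟩)
        · exact absurd ht2 this
      have h5 := Finset.card_le_card (Finset.filter_subset (fun t => v ∈ E t.val) S)
      rw [hQ, Finset.card_univ, Fintype.card_fin] at h5
      omega
    · exact Finset.biUnion_mono fun s _ => hAsub s
  have hdisj : ∀ s ∈ S, ∀ t ∈ S, s ≠ t → Disjoint (A s) (A t) := by
    intro s hs t ht hst
    rw [Finset.disjoint_left]
    intro v h1 h2
    rcases hyper_adj hm h hst (hAsub _ h1) (hAsub _ h2) with rfl | rfl
    · exact hA s v ht h1 (hAsub _ h2)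
    · exact hA t v hs h2 (hAsub _ h1)
  rw [hU, Finset.card_biUnion hdisj]
  have hc : ∀ s, (A s).card + α * (if s + 1 ∈ S then 1 else 0) = d := by
    intro s
    simp only [A]
    have hd := h.card_eq s.val s.2
    split_ifs with h1
    · have h2 := Finset.card_sdiff_add_card_inter (E s.val) (E (s + 1).val)
      rw [hyper_inter hm h] at h2
      omega
    · simpa using hd
  have : cadj S = ∑ s ∈ S, if s + 1 ∈ S then 1 else 0 := by
    rw [cadj, Finset.card_filter]
  rw [this, Finset.mul_sum, ← Finset.sum_add_distrib, Finset.sum_congr rfl (fun s _ => hc s),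
    Finset.sum_const, smul_eq_mul]

lemma hyper_pos {m d α : ℕ} {E : ℕ → Finset V} (hm : 1 ≤ m)
    (h : IsHypercycle (m + 1) d α E) : 0 < α := by
  have h1 : (0 + 1) % (m + 1) = 1 := Nat.mod_eq_of_lt (by omega)
  have h2 := h.inter_card 0 (by omega)
  rw [h1] at h2
  rw [← h2, Finset.card_pos]
  exact (h.inter_nonempty_iff 0 (by omega) 1 (by omega) (by omega)).2 (Or.inl h1)

end hyper

/-- Let `C_n^{d,α}` be a hypercycle with `d > 2α` and let `1 ≤ i < n`.
Then for every `r` with `1 ≤ r ≤ i`,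
`β_{i, i·d - α·(i-r)}(R ⧸ I(C_n^{d,α})) = (n/r) · C(i-1, r-1) · C(n-i-1, r-1)`
(an identity of rational numbers), and `β_{i,j} = 0` for every `j` not of the form
`i·d - α·(i-r)` with `1 ≤ r ≤ i`. -/
theorem gradedBetti_hypercycle (k V : Type) [Field k] [Fintype V] [DecidableEq V]
    (n d α i : ℕ) (E : ℕ → Finset V)
    (hd : 2 * α < d) (hi : 1 ≤ i) (hin : i < n)
    (hcycle : IsHypercycle n d α E)
    (F : MinimalGradedFreeResolution k V (edgeIdeal k (fun l : Fin n => E l.val))) :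
    (∀ r, 1 ≤ r → r ≤ i →
        (F.β i (i * d - α * (i - r)) : ℚ) =
          ((n : ℚ) / r) * (i - 1).choose (r - 1) * (n - i - 1).choose (r - 1)) ∧
      (∀ j, (∀ r, 1 ≤ r → r ≤ i → j ≠ i * d - α * (i - r)) → F.β i j = 0) := by

  obtain ⟨m, rfl⟩ : ∃ m, n = m + 1 := ⟨n - 1, by omega⟩
  have hm : 1 ≤ m := by omega
  have hα := hyper_pos hm hcycle
  have hβ := beta_eq_card _ (hyper_private hm hd hcycle) F i
  constructor
  · intro r hr hri
    have e : F.β i (i * d - α * (i - r)) = (CS m i r).card := by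
      rw [hβ]
      congr 1
      ext S
      simp only [CS, Finset.mem_filter, Finset.mem_univ, true_and]
      refine and_congr_right fun hS => ?_
      have hu := hyper_union hm hcycle S (by omega)
      rw [hS] at hu
      have h1 : α * (i - r) ≤ i * d := by
        calc α * (i - r) ≤ d * i := Nat.mul_le_mul (by omega) (by omega)
          _ = i * d := mul_comm _ _
      constructor
      · intro h
        have h2 : α * cadj S = α * (i - r) := by omega
        have := Nat.eq_of_mul_eq_mul_left hα h2
        omega
      · intro h
        have : cadj S = i - r := by omega
        rw [this] at hu
        omega
    have hc := CS_card m i r hi (by omega) hr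
    have e2 : m + 1 - i - 1 = m - i := by omega
    rw [e, e2]
    have hr0 : (r : ℚ) ≠ 0 := by positivity
    have hc' : (r : ℚ) * (CS m i r).card =
        ((m + 1 : ℕ) : ℚ) * ((i - 1).choose (r - 1) * (m - i).choose (r - 1)) := by
      exact_mod_cast hc
    field_simp
    rw [mul_comm, hc']
    ring
  · intro j hj
    rw [hβ, Finset.card_eq_zero, Finset.eq_empty_iff_forall_notMem]
    intro S hS
    simp only [Finset.mem_filter, Finset.mem_univ, true_and] at hS
    obtain ⟨h1, h2⟩ := hS
    have hu := hyper_union hm hcycle S (by omega)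
    have hlt := cadj_lt (S := S) (Finset.card_pos.1 (by omega)) (by omega)
    refine hj (i - cadj S) (by omega) (by omega) ?_
    have : i - (i - cadj S) = cadj S := by omega
    rw [this]
    rw [h1] at hu
    omega
end

section
/- Let H be a d-uniform hypergraph with edges E_1,...,E_n such that for some fixed alpha, for all i ≠ j one has |E_i ∩ E_j| = |E_1 ∩ ... ∩ E_n| = alpha, and each edge has a free vertex. Then beta_{i,j}(R/I(H)) ≠ 0 if and only if j = i*d - alpha*(i-1), and beta_{i, i*d - alpha*(i-1)}(R/I(H)) = C(n, i). -/
open MvPolynomial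

namespace StarBetti

/-- Expansion of a linear map between free modules in coordinates. -/
lemma map_apply_eq {R ι κ : Type} [CommRing R] (L : (ι →₀ R) →ₗ[R] (κ →₀ R))
    (f : ι →₀ R) (q : κ) :
    (L f) q = ∑ p ∈ f.support, f p * (L (Finsupp.single p 1)) q := by
  conv_lhs => rw [← Finsupp.sum_single f]
  rw [Finsupp.sum, map_sum, Finsupp.finsetSum_apply]
  refine Finset.sum_congr rfl fun p _ => ?_
  have : Finsupp.single p (f p) = f p • Finsupp.single p (1 : R) := by simp
  rw [this, map_smul, Finsupp.smul_apply, smul_eq_mul]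

section
variable {k V : Type} [Field k]

/-- All the internal degrees occurring in `f` satisfy `P`. -/
def HomP {ι : Type} (deg : ι → ℕ) (P : ℕ → Prop) (f : ι →₀ MvPolynomial V k) : Prop :=
  ∀ p w, coeff w (f p) ≠ 0 → P (w.degree + deg p)

/-- graded linear map -/
def GrMap {ι κ : Type} (degι : ι → ℕ) (degκ : κ → ℕ)
    (L : (ι →₀ MvPolynomial V k) →ₗ[MvPolynomial V k] (κ →₀ MvPolynomial V k)) : Prop :=
  ∀ e q w, coeff w ((L (Finsupp.single e 1)) q) ≠ 0 → w.degree + degκ q = degι e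

lemma GrMap.homP {ι κ : Type} {degι : ι → ℕ} {degκ : κ → ℕ}
    {L : (ι →₀ MvPolynomial V k) →ₗ[MvPolynomial V k] (κ →₀ MvPolynomial V k)}
    (hL : GrMap degι degκ L) {P : ℕ → Prop} {f : ι →₀ MvPolynomial V k}
    (hf : HomP degι P f) : HomP degκ P (L f) := by
  classical
  intro q w hw
  rw [map_apply_eq, coeff_sum] at hw
  obtain ⟨p, -, hp⟩ := Finset.exists_ne_zero_of_sum_ne_zero hw
  rw [coeff_mul] at hp
  obtain ⟨⟨u, v⟩, huv, h⟩ := Finset.exists_ne_zero_of_sum_ne_zero hp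
  have h1 := hf p u (left_ne_zero_of_mul h)
  have h2 := hL p q v (right_ne_zero_of_mul h)
  replace huv : u + v = w := Finset.HasAntidiagonal.mem_antidiagonal.1 huv
  rw [← huv, map_add, add_assoc, h2]
  exact h1

/-- the part of a polynomial on monomials satisfying a predicate -/
lemma exists_part (p : MvPolynomial V k) (Q : (V →₀ ℕ) → Prop) :
    ∃ r : MvPolynomial V k, (∀ w, Q w → coeff w r = coeff w p) ∧ (∀ w, ¬ Q w → coeff w r = 0) := by
  classical
  refine ⟨∑ w ∈ p.support.filter Q, monomial w (coeff w p), ?_, ?_⟩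
  · intro w hw
    simp only [coeff_sum, coeff_monomial, Finset.sum_ite_eq', Finset.mem_filter, hw, and_true]
    split_ifs with h
    · rfl
    · simpa using (notMem_support_iff.1 h).symm
  · intro w hw
    simp [coeff_sum, coeff_monomial, Finset.sum_ite_eq', Finset.mem_filter, hw]

lemma exists_vec_part {ι : Type} (deg : ι → ℕ) (j : ℕ) (g : ι →₀ MvPolynomial V k) :
    ∃ g' : ι →₀ MvPolynomial V k, HomP deg (fun m => m = j) g' ∧
      HomP deg (fun m => m ≠ j) (g - g') := by
  classical
  choose r hr1 hr2 using fun p => exists_part (g p) (fun w => w.degree + deg p = j)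
  have hr0 : ∀ p, r p ≠ 0 → p ∈ g.support := by
    intro p hp
    rw [Finsupp.mem_support_iff]
    intro h0
    apply hp
    ext w
    by_cases hw : w.degree + deg p = j
    · rw [hr1 p w hw, h0]
    · rw [hr2 p w hw, coeff_zero]
  refine ⟨Finsupp.onFinset g.support r hr0, ?_, ?_⟩
  · intro p w hw
    by_contra hne
    exact hw (hr2 p w hne)
  · intro p w hw h
    apply hw
    simp [hr1 p w h]

lemma GrMap.exists_lift {ι κ : Type} {degι : ι → ℕ} {degκ : κ → ℕ}
    {L : (ι →₀ MvPolynomial V k) →ₗ[MvPolynomial V k] (κ →₀ MvPolynomial V k)}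
    (hL : GrMap degι degκ L) {j : ℕ} {f : κ →₀ MvPolynomial V k}
    (hf : HomP degκ (fun m => m = j) f) (hr : f ∈ LinearMap.range L) :
    ∃ g, HomP degι (fun m => m = j) g ∧ L g = f := by
  obtain ⟨g, rfl⟩ := hr
  obtain ⟨g', h1, h2⟩ := exists_vec_part degι j g
  refine ⟨g', h1, ?_⟩
  have h3 := hL.homP h1
  have h4 := hL.homP h2
  ext q w
  by_contra hne
  have h5 : coeff w ((L (g - g')) q) ≠ 0 := by
    intro h
    rw [map_sub, Finsupp.sub_apply, coeff_sub, sub_eq_zero] at h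
    exact hne h.symm
  have h6 := h4 q w h5
  apply hne
  have h7 : coeff w ((L g') q) = 0 := by
    by_contra h; exact h6 (h3 q w h)
  have h8 : coeff w ((L g) q) = 0 := by
    by_contra h; exact h6 (hf q w h)
  rw [h7, h8]

/-- graded lifting of a map through `L` -/
lemma GrMap.exists_lift_map {ι κ μ : Type} {degι : ι → ℕ} {degκ : κ → ℕ} {degμ : μ → ℕ}
    {L : (ι →₀ MvPolynomial V k) →ₗ[MvPolynomial V k] (κ →₀ MvPolynomial V k)}
    (hL : GrMap degι degκ L)
    {N : (μ →₀ MvPolynomial V k) →ₗ[MvPolynomial V k] (κ →₀ MvPolynomial V k)}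
    (hN : GrMap degμ degκ N) (hr : ∀ x, N x ∈ LinearMap.range L) :
    ∃ φ : (μ →₀ MvPolynomial V k) →ₗ[MvPolynomial V k] (ι →₀ MvPolynomial V k),
      GrMap degμ degι φ ∧ ∀ x, L (φ x) = N x := by
  have : ∀ e : μ, ∃ g, HomP degι (fun m => m = degμ e) g ∧ L g = N (Finsupp.single e 1) :=
    fun e => hL.exists_lift (fun q w h => hN e q w h) (hr _)
  choose g hg1 hg2 using this
  refine ⟨Finsupp.linearCombination _ g, ?_, ?_⟩
  · intro e q w h
    rw [Finsupp.linearCombination_single, one_smul] at h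
    exact hg1 e q w h
  · intro x
    rw [← LinearMap.comp_apply]
    congr 1
    apply Finsupp.lhom_ext'
    intro e
    apply LinearMap.ext_ring
    simp [hg2]

lemma exists_lift_map {R ι κ μ : Type} [CommRing R]
    {L : (ι →₀ R) →ₗ[R] (κ →₀ R)} {N : (μ →₀ R) →ₗ[R] (κ →₀ R)}
    (hr : ∀ x, N x ∈ LinearMap.range L) :
    ∃ φ : (μ →₀ R) →ₗ[R] (ι →₀ R), ∀ x, L (φ x) = N x := by
  have : ∀ e : μ, ∃ g, L g = N (Finsupp.single e 1) := fun e => hr _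
  choose g hg2 using this
  refine ⟨Finsupp.linearCombination _ g, ?_⟩
  intro x
  rw [← LinearMap.comp_apply]
  congr 1
  apply Finsupp.lhom_ext'
  intro e
  apply LinearMap.ext_ring
  simp [hg2]

lemma const_map {ι κ : Type}
    (L : (ι →₀ MvPolynomial V k) →ₗ[MvPolynomial V k] (κ →₀ MvPolynomial V k))
    {f : ι →₀ MvPolynomial V k} (hf : ∀ p, constantCoeff (f p) = 0) (q : κ) :
    constantCoeff ((L f) q) = 0 := by
  rw [map_apply_eq, map_sum]
  exact Finset.sum_eq_zero fun p _ => by rw [map_mul, hf, zero_mul]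

lemma GrMap.comp {ι κ μ : Type} {degι : ι → ℕ} {degκ : κ → ℕ} {degμ : μ → ℕ}
    {L : (ι →₀ MvPolynomial V k) →ₗ[MvPolynomial V k] (κ →₀ MvPolynomial V k)}
    (hL : GrMap degι degκ L)
    {N : (μ →₀ MvPolynomial V k) →ₗ[MvPolynomial V k] (ι →₀ MvPolynomial V k)}
    (hN : GrMap degμ degι N) : GrMap degμ degκ (L ∘ₗ N) := by
  intro e q w h
  exact hL.homP (P := fun m => m = degμ e) (f := N (Finsupp.single e 1))
    (fun q w h => hN e q w h) q w h

variable (k V) in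
/-- graded minimal free resolution with arbitrary bases -/
structure GRes (I : Ideal (MvPolynomial V k)) where
  ι : ℕ → Type
  deg : ∀ i, ι i → ℕ
  d : ∀ i, (ι (i + 1) →₀ MvPolynomial V k) →ₗ[MvPolynomial V k] (ι i →₀ MvPolynomial V k)
  exact_succ : ∀ i, LinearMap.ker (d i) = LinearMap.range (d (i + 1))
  minimal : ∀ i x p, constantCoeff ((d i x) p) = 0
  graded : ∀ i, GrMap (deg (i + 1)) (deg i) (d i)
  p0 : ι 0
  uniq : ∀ p, p = p0
  deg0 : deg 0 p0 = 0
  range_zero : ∀ f, f ∈ LinearMap.range (d 0) ↔ f p0 ∈ I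

variable {I : Ideal (MvPolynomial V k)}

lemma GRes.dd (A : GRes k V I) (i : ℕ) (x) : A.d i (A.d (i + 1) x) = 0 := by
  have : A.d (i + 1) x ∈ LinearMap.ker (A.d i) := by
    rw [A.exact_succ]; exact ⟨x, rfl⟩
  exact this

lemma comparison (A B : GRes k V I) (i : ℕ) :
    ∃ (φ : (A.ι i →₀ MvPolynomial V k) →ₗ[MvPolynomial V k] (B.ι i →₀ MvPolynomial V k))
      (ψ : (B.ι i →₀ MvPolynomial V k) →ₗ[MvPolynomial V k] (A.ι i →₀ MvPolynomial V k))
      (h : (A.ι i →₀ MvPolynomial V k) →ₗ[MvPolynomial V k] (A.ι (i + 1) →₀ MvPolynomial V k)),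
      GrMap (A.deg i) (B.deg i) φ ∧ GrMap (B.deg i) (A.deg i) ψ ∧
      (∀ x, φ (A.d i x) ∈ LinearMap.range (B.d i)) ∧
      (∀ x, ψ (B.d i x) ∈ LinearMap.range (A.d i)) ∧
      (∀ x, ψ (φ (A.d i x)) - A.d i x - A.d i (h (A.d i x)) = 0) ∧
      (∀ x p, constantCoeff ((ψ (φ x) - x) p) = 0) := by
  classical
  induction i with
  | zero =>
    let φ : (A.ι 0 →₀ MvPolynomial V k) →ₗ[MvPolynomial V k] (B.ι 0 →₀ MvPolynomial V k) :=
      Finsupp.lmapDomain _ _ (fun _ => B.p0)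
    let ψ : (B.ι 0 →₀ MvPolynomial V k) →ₗ[MvPolynomial V k] (A.ι 0 →₀ MvPolynomial V k) :=
      Finsupp.lmapDomain _ _ (fun _ => A.p0)
    have hA : ∀ f : A.ι 0 →₀ MvPolynomial V k, f = Finsupp.single A.p0 (f A.p0) := by
      intro f; ext1 p; rw [A.uniq p]; simp
    have hB : ∀ f : B.ι 0 →₀ MvPolynomial V k, f = Finsupp.single B.p0 (f B.p0) := by
      intro f; ext1 p; rw [B.uniq p]; simp
    have hφ : ∀ f, φ f = Finsupp.single B.p0 (f A.p0) := by
      intro f; conv_lhs => rw [hA f]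
      simp [φ]
    have hψ : ∀ f, ψ f = Finsupp.single A.p0 (f B.p0) := by
      intro f; conv_lhs => rw [hB f]
      simp [ψ]
    have hψφ : ∀ f, ψ (φ f) = f := by
      intro f; rw [hφ, hψ]; conv_rhs => rw [hA f]
      simp
    refine ⟨φ, ψ, 0, ?_, ?_, ?_, ?_, ?_, ?_⟩
    · intro e q w h
      rw [hφ, A.uniq e, B.uniq q, Finsupp.single_eq_same, Finsupp.single_eq_same, coeff_one] at h
      rw [B.uniq q, A.uniq e, A.deg0, B.deg0]
      split_ifs at h with h0
      · simp [← h0]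
      · simp at h
    · intro e q w h
      rw [hψ, B.uniq e, A.uniq q, Finsupp.single_eq_same, Finsupp.single_eq_same, coeff_one] at h
      rw [A.uniq q, B.uniq e, A.deg0, B.deg0]
      split_ifs at h with h0
      · simp [← h0]
      · simp at h
    · intro x
      rw [hφ, B.range_zero, Finsupp.single_eq_same, ← A.range_zero]
      exact ⟨x, rfl⟩
    · intro x
      rw [hψ, A.range_zero, Finsupp.single_eq_same, ← B.range_zero]
      exact ⟨x, rfl⟩
    · intro x; simp [hψφ]
    · intro x p; simp [hψφ]
  | succ i ih =>
    obtain ⟨φ, ψ, h, hφ, hψ, hφr, hψr, hh, -⟩ := ih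
    obtain ⟨φ', hφ', hφd⟩ := (B.graded i).exists_lift_map (hφ.comp (A.graded i)) hφr
    obtain ⟨ψ', hψ', hψd⟩ := (A.graded i).exists_lift_map (hψ.comp (B.graded i)) hψr
    simp only [LinearMap.comp_apply] at hφd hψd
    let N : (A.ι (i + 1) →₀ MvPolynomial V k) →ₗ[MvPolynomial V k]
      (A.ι (i + 1) →₀ MvPolynomial V k) := ψ' ∘ₗ φ' - LinearMap.id - h ∘ₗ A.d i
    have hN : ∀ x, N x = ψ' (φ' x) - x - h (A.d i x) := fun x => rfl
    have hker : ∀ x, N x ∈ LinearMap.range (A.d (i + 1)) := by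
      intro x
      rw [← A.exact_succ, LinearMap.mem_ker]
      rw [hN, map_sub, map_sub, hψd, hφd]
      exact hh x
    obtain ⟨h', hh'⟩ := exists_lift_map hker
    simp only [hN] at hh'
    refine ⟨φ', ψ', h', hφ', hψ', ?_, ?_, ?_, ?_⟩
    · intro x
      rw [← B.exact_succ, LinearMap.mem_ker, hφd, A.dd, map_zero]
    · intro x
      rw [← A.exact_succ, LinearMap.mem_ker, hψd, B.dd, map_zero]
    · intro x
      rw [hh', A.dd, map_zero]; simp
    · intro x p
      have h1 : ψ' (φ' x) - x = A.d (i + 1) (h' x) + h (A.d i x) := by rw [hh']; abel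
      rw [h1, Finsupp.add_apply, map_add, A.minimal, const_map h (A.minimal i x), add_zero]

lemma card_le (A B : GRes k V I) (i j : ℕ) [Finite {e : A.ι i // A.deg i e = j}]
    [Finite {e : B.ι i // B.deg i e = j}] :
    Nat.card {e : A.ι i // A.deg i e = j} ≤ Nat.card {e : B.ι i // B.deg i e = j} := by
  classical
  obtain ⟨φ, ψ, h, hφ, hψ, -, -, -, hc⟩ := comparison A B i
  have := Fintype.ofFinite {e : A.ι i // A.deg i e = j}
  have := Fintype.ofFinite {e : B.ι i // B.deg i e = j}
  let M : Matrix {e : A.ι i // A.deg i e = j} {e : B.ι i // B.deg i e = j} k :=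
    fun a b => constantCoeff ((φ (Finsupp.single a.1 1)) b.1)
  let N : Matrix {e : B.ι i // B.deg i e = j} {e : A.ι i // A.deg i e = j} k :=
    fun b a => constantCoeff ((ψ (Finsupp.single b.1 1)) a.1)
  have hMN : M * N = 1 := by
    ext a a'
    have h1 := hc (Finsupp.single a.1 1) a'.1
    rw [Finsupp.sub_apply, map_sub, sub_eq_zero] at h1
    have h2 : constantCoeff ((Finsupp.single a.1 (1 : MvPolynomial V k)) a'.1)
        = (1 : Matrix _ _ k) a a' := by
      rw [Finsupp.single_apply, Matrix.one_apply]
      simp only [Subtype.ext_iff]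
      split_ifs <;> simp
    rw [h2, map_apply_eq, map_sum] at h1
    rw [← h1, Matrix.mul_apply]
    have h3 : ∀ p, p ∉ (φ (Finsupp.single a.1 1)).support →
        constantCoeff ((φ (Finsupp.single a.1 1)) p) = 0 := by
      intro p hp; rw [Finsupp.notMem_support_iff.1 hp, map_zero]
    have h4 : ∀ p, B.deg i p ≠ j → constantCoeff ((φ (Finsupp.single a.1 1)) p) = 0 := by
      intro p hp
      by_contra hne
      have := hφ a.1 p 0 hne
      apply hp
      rw [← a.2, ← this]; simp
    symm
    refine Finset.sum_bij_ne_zero (fun p _ hp => ⟨p, ?_⟩) ?_ ?_ ?_ ?_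
    · by_contra hne
      apply hp
      rw [map_mul, h4 p hne, zero_mul]
    · intros; exact Finset.mem_univ _
    · intro a₁ _ _ a₂ _ _ h
      exact congrArg Subtype.val h
    · intro b _ hb
      refine ⟨b.1, ?_, ?_, rfl⟩
      · by_contra hne
        apply hb
        change constantCoeff _ * _ = 0
        rw [h3 _ hne, zero_mul]
      · rw [map_mul]; exact hb
    · intro p _ _
      exact map_mul _ _ _
  have := Matrix.rank_mul_le_left M N
  rw [hMN, Matrix.rank_one] at this
  rw [Nat.card_eq_fintype_card, Nat.card_eq_fintype_card]
  exact this.trans (Matrix.rank_le_card_width M)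

end

section combin
variable {n : ℕ} {R : Type} [CommRing R]

/-- the simplicial sign -/
def sg (R : Type) [CommRing R] {n : ℕ} (s : Fin n) (S : Finset (Fin n)) : R :=
  (-1) ^ (S.filter (· < s)).card

lemma sg_mul_self (s : Fin n) (S : Finset (Fin n)) : sg R s S * sg R s S = 1 := by
  unfold sg
  rw [← mul_pow]; simp

lemma sg_insert (s t : Fin n) (S : Finset (Fin n)) (hst : t ∉ S) :
    sg R s (insert t S) = if t < s then - sg R s S else sg R s S := by
  unfold sg
  rw [Finset.filter_insert]
  split_ifs with h
  · rw [Finset.card_insert_of_notMem (by simp [hst]), pow_succ]; ring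
  · rfl

lemma sg_swap (s t : Fin n) (S : Finset (Fin n)) (hs : s ∉ S) (ht : t ∉ S) (hne : s ≠ t) :
    sg R s (insert t S) * sg R t (insert s S) = - (sg R s S * sg R t S) := by
  rw [sg_insert s t S ht, sg_insert t s S hs]
  rcases lt_or_gt_of_ne hne with h | h
  · rw [if_neg (not_lt.2 h.le), if_pos h]; ring
  · rw [if_pos h, if_neg (not_lt.2 h.le)]; ring

lemma sg_swap' (s t : Fin n) (S : Finset (Fin n)) (hs : s ∉ S) (ht : t ∉ S) (hne : s ≠ t) :
    sg R s S * sg R t (insert s S) + sg R t S * sg R s (insert t S) = 0 := by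
  rw [sg_insert s t S ht, sg_insert t s S hs]
  rcases lt_or_gt_of_ne hne with h | h
  · rw [if_neg (not_lt.2 h.le), if_pos h]; ring
  · rw [if_pos h, if_neg (not_lt.2 h.le)]; ring

/-- simplicial boundary -/
def bd (f : Finset (Fin n) → R) (S : Finset (Fin n)) : R :=
  ∑ s ∈ Sᶜ, sg R s S * f (insert s S)

lemma bd_bd (f : Finset (Fin n) → R) (S : Finset (Fin n)) : bd (bd f) S = 0 := by
  unfold bd
  simp only [Finset.mul_sum]
  rw [Finset.sum_sigma']
  refine Finset.sum_involution (fun p _ => ⟨p.2, p.1⟩) ?_ ?_ ?_ ?_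
  · rintro ⟨s, t⟩ h
    simp only [Finset.mem_sigma, Finset.mem_compl, Finset.mem_insert, not_or] at h
    simp only
    rw [Finset.insert_comm t s, ← mul_assoc, ← mul_assoc, ← add_mul,
      sg_swap' s t S h.1 h.2.2 (Ne.symm h.2.1), zero_mul]
  · rintro ⟨s, t⟩ h _ heq
    simp only [Finset.mem_sigma, Finset.mem_compl, Finset.mem_insert, not_or] at h
    simp only [Sigma.mk.injEq] at heq
    exact h.2.1 heq.1
  · rintro ⟨s, t⟩ h
    simp only [Finset.mem_sigma, Finset.mem_compl, Finset.mem_insert, not_or] at h ⊢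
    exact ⟨h.2.2, Ne.symm h.2.1, h.1⟩
  · rintro ⟨s, t⟩ h
    rfl

/-- cone homotopy -/
def hm (s₀ : Fin n) (f : Finset (Fin n) → R) (S : Finset (Fin n)) : R :=
  if s₀ ∈ S then sg R s₀ (S.erase s₀) * f (S.erase s₀) else 0

lemma bd_hm (s₀ : Fin n) (f : Finset (Fin n) → R) (S : Finset (Fin n)) :
    bd (hm s₀ f) S + hm s₀ (bd f) S = f S := by
  by_cases h : s₀ ∈ S
  · obtain ⟨U, hU, rfl⟩ : ∃ U, s₀ ∉ U ∧ S = insert s₀ U :=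
      ⟨S.erase s₀, Finset.notMem_erase _ _, (Finset.insert_erase h).symm⟩
    have hc : Uᶜ = insert s₀ (insert s₀ U)ᶜ := by
      ext x; simp only [Finset.mem_compl, Finset.mem_insert]
      by_cases hx : x = s₀
      · simp [hx, hU]
      · simp [hx]
    unfold hm bd
    rw [if_pos h, Finset.erase_insert hU, hc, Finset.sum_insert (by simp), mul_add, ← mul_assoc,
      sg_mul_self, one_mul, add_comm, add_assoc, add_eq_left, Finset.mul_sum,
      ← Finset.sum_add_distrib]
    refine Finset.sum_eq_zero fun s hs => ?_
    simp only [Finset.mem_compl, Finset.mem_insert, not_or] at hs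
    have hi : s₀ ∈ insert s (insert s₀ U) := by simp
    beta_reduce
    rw [if_pos hi, Finset.insert_comm s s₀, Finset.erase_insert (by simp [hU, Ne.symm hs.1]),
      ← mul_assoc, ← mul_assoc, sg_swap s s₀ U hs.2 hU hs.1]
    ring
  · unfold hm bd
    rw [if_neg h, add_zero, Finset.sum_eq_single s₀]
    · beta_reduce
      rw [if_pos (Finset.mem_insert_self _ _), Finset.erase_insert h, ← mul_assoc, sg_mul_self,
        one_mul]
    · intro b _ hb
      beta_reduce
      rw [if_neg (by simp [h, Ne.symm hb]), mul_zero]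
    · intro h'; simp [h] at h'

end combin

section taylor
variable {k V : Type} [Field k] [DecidableEq V] {n : ℕ}

/-- squarefree monomial -/
noncomputable def xm (k : Type) [Field k] (W : Finset V) : MvPolynomial V k := ∏ v ∈ W, X v

/-- exponent of the squarefree monomial -/
noncomputable def ex (W : Finset V) : V →₀ ℕ := ∑ v ∈ W, Finsupp.single v 1

lemma ex_apply (W : Finset V) (v : V) : ex W v = if v ∈ W then 1 else 0 := by
  simp [ex, Finsupp.finsetSum_apply, Finsupp.single_apply]

lemma xm_eq (W : Finset V) : xm k W = monomial (ex W) 1 := by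
  unfold xm ex
  rw [monomial_sum_one]
  rfl

lemma ex_degree (W : Finset V) : (ex W).degree = W.card := by
  simp [ex, map_sum]

lemma xm_ne_zero (W : Finset V) : xm k W ≠ 0 := by
  rw [xm_eq]; simp

lemma xm_dvd (W : Finset V) (p : MvPolynomial V k) :
    xm k W ∣ p ↔ ∀ w, coeff w p ≠ 0 → ∀ v ∈ W, w v ≠ 0 := by
  have hle : ∀ w : V →₀ ℕ, ex W ≤ w ↔ ∀ v ∈ W, w v ≠ 0 := by
    intro w
    rw [Finsupp.le_def]
    constructor
    · intro h v hv
      have := h v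
      rw [ex_apply, if_pos hv] at this
      omega
    · intro h v
      rw [ex_apply]
      split_ifs with hv
      · have := h v hv; omega
      · omega
  rw [xm_eq, monomial_one_dvd_iff_modMonomial_eq_zero]
  constructor
  · intro h w hw
    rw [← hle]
    by_contra hn
    apply hw
    rw [← coeff_modMonomial_of_not_le p hn, h, coeff_zero]
  · intro h
    ext w
    rw [coeff_zero]
    by_cases hw : ex W ≤ w
    · exact coeff_modMonomial_of_le p hw
    · rw [coeff_modMonomial_of_not_le p hw]
      by_contra hne
      exact hw ((hle w).2 (h w hne))

lemma coeff_sg_mul (w : V →₀ ℕ) (s : Fin n) (S : Finset (Fin n)) (p : MvPolynomial V k) :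
    coeff w (sg (MvPolynomial V k) s S * p) = sg k s S * coeff w p := by
  have : sg (MvPolynomial V k) s S = C (sg k s S) := by
    unfold sg; simp
  rw [this, coeff_C_mul]

lemma coeff_bd (w : V →₀ ℕ) (g : Finset (Fin n) → MvPolynomial V k) (S : Finset (Fin n)) :
    coeff w (bd g S) = bd (fun T => coeff w (g T)) S := by
  unfold bd
  rw [coeff_sum]
  exact Finset.sum_congr rfl fun s _ => coeff_sg_mul _ _ _ _

lemma exists_bd (E : Fin n → Finset V) (g : Finset (Fin n) → MvPolynomial V k)
    (hdiv : ∀ T, xm k (T.biUnion E) ∣ g T) (m : ℕ) (hm0 : m ≠ 0)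
    (hsupp : ∀ T, T.card ≠ m → g T = 0) (hbd : ∀ S, bd g S = 0) :
    ∃ g' : Finset (Fin n) → MvPolynomial V k, (∀ S, bd g' S = g S) ∧
      (∀ T, xm k (T.biUnion E) ∣ g' T) ∧ (∀ T, T.card ≠ m + 1 → g' T = 0) := by
  classical
  let P : (V →₀ ℕ) → Prop := fun w => ∃ s, ∀ v ∈ E s, w v ≠ 0
  let c : (V →₀ ℕ) → Finset (Fin n) → k := fun w T => coeff w (g T)
  let G : (V →₀ ℕ) → Finset (Fin n) → k := fun w S =>
    if h : P w then hm h.choose (c w) S else 0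
  let W : Finset (V →₀ ℕ) := Finset.univ.biUnion fun T => (g T).support
  have hG : ∀ w S, G w S ≠ 0 → ∃ s, s ∈ S ∧ (∀ v ∈ E s, w v ≠ 0) ∧ c w (S.erase s) ≠ 0 := by
    intro w S h
    simp only [G] at h
    split_ifs at h with hP
    · unfold hm at h
      split_ifs at h with hs
      · exact ⟨hP.choose, hs, hP.choose_spec, right_ne_zero_of_mul h⟩
      · exact absurd rfl h
    · exact absurd rfl h
  have hGW : ∀ w S, G w S ≠ 0 → w ∈ W := by
    intro w S h
    obtain ⟨s, -, -, h⟩ := hG w S h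
    simp only [W, Finset.mem_biUnion, Finset.mem_univ, true_and]
    exact ⟨_, mem_support_iff.2 h⟩
  let g' : Finset (Fin n) → MvPolynomial V k := fun S => ∑ w ∈ W, monomial w (G w S)
  have hg' : ∀ w S, coeff w (g' S) = G w S := by
    intro w S
    simp only [g', coeff_sum, coeff_monomial, Finset.sum_ite_eq']
    split_ifs with h
    · rfl
    · by_contra hne
      exact h (hGW w S (Ne.symm hne))
  have hcd : ∀ w T, c w T ≠ 0 → ∀ v ∈ T.biUnion E, w v ≠ 0 := fun w T h =>
    (xm_dvd _ _).1 (hdiv T) w h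
  refine ⟨g', ?_, ?_, ?_⟩
  · intro S
    ext w
    rw [coeff_bd]
    simp only [hg']
    by_cases hP : P w
    · have h1 : (fun T => G w T) = hm hP.choose (c w) := by
        funext T; simp only [G, dif_pos hP]
      have h2 : bd (c w) = fun _ => 0 := by
        funext T
        rw [← coeff_bd, hbd, coeff_zero]
      have h3 := bd_hm hP.choose (c w) S
      rw [h2] at h3
      rw [h1]
      have h4 : hm hP.choose (fun _ => (0 : k)) S = 0 := by simp [hm]
      rw [h4, add_zero] at h3
      exact h3
    · have h1 : (fun T => G w T) = fun _ => 0 := by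
        funext T; simp only [G, dif_neg hP]
      rw [h1]
      have h2 : coeff w (g S) = 0 := by
        by_contra hne
        have hS : S.Nonempty := by
          rw [Finset.nonempty_iff_ne_empty]
          rintro rfl
          apply hne
          rw [hsupp ∅ (by simpa using Ne.symm hm0), coeff_zero]
        obtain ⟨s, hs⟩ := hS
        exact hP ⟨s, fun v hv => hcd w S hne v (Finset.mem_biUnion.2 ⟨s, hs, hv⟩)⟩
      rw [h2]
      simp [bd]
  · intro T
    rw [xm_dvd]
    intro w hw v hv
    rw [hg'] at hw
    obtain ⟨s, hs, h1, h2⟩ := hG w T hw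
    obtain ⟨t, ht, htv⟩ := Finset.mem_biUnion.1 hv
    by_cases hst : t = s
    · subst hst; exact h1 v htv
    · exact hcd w _ h2 v (Finset.mem_biUnion.2 ⟨t, Finset.mem_erase.2 ⟨hst, ht⟩, htv⟩)
  · intro T hT
    ext w
    rw [hg', coeff_zero]
    by_contra hne
    obtain ⟨s, hs, h1, h2⟩ := hG w T hne
    apply h2
    simp only [c]
    rw [hsupp, coeff_zero]
    have := Finset.card_erase_add_one hs
    omega

/-- subsets of size `i` -/
abbrev Idx (n i : ℕ) : Type := {S : Finset (Fin n) // S.card = i}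

/-- extension by zero -/
noncomputable def extz {i : ℕ} (f : Idx n i →₀ MvPolynomial V k) (T : Finset (Fin n)) :
    MvPolynomial V k := if h : T.card = i then f ⟨T, h⟩ else 0

/-- Taylor differential -/
noncomputable def tD (k : Type) [Field k] (E : Fin n → Finset V) (i : ℕ) :
    (Idx n (i + 1) →₀ MvPolynomial V k) →ₗ[MvPolynomial V k] (Idx n i →₀ MvPolynomial V k) where
  toFun f := Finsupp.equivFunOnFinite.symm fun S => ∑ s ∈ S.1ᶜ, sg (MvPolynomial V k) s S.1 *
    (xm k ((insert s S.1).biUnion E \ S.1.biUnion E) * extz f (insert s S.1))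
  map_add' f g := by
    ext1 S
    simp only [Finsupp.equivFunOnFinite_symm_apply_apply, Finsupp.add_apply]
    rw [← Finset.sum_add_distrib]
    refine Finset.sum_congr rfl fun s _ => ?_
    unfold extz
    split_ifs
    · rw [Finsupp.add_apply]; ring
    · ring
  map_smul' r f := by
    ext1 S
    simp only [Finsupp.equivFunOnFinite_symm_apply_apply, Finsupp.smul_apply, RingHom.id_apply,
      smul_eq_mul]
    rw [Finset.mul_sum]
    refine Finset.sum_congr rfl fun s _ => ?_
    unfold extz
    split_ifs
    · rw [Finsupp.smul_apply, smul_eq_mul]; ring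
    · ring

lemma tD_apply (E : Fin n → Finset V) (i : ℕ) (f : Idx n (i + 1) →₀ MvPolynomial V k)
    (S : Idx n i) : tD k E i f S = ∑ s ∈ S.1ᶜ, sg (MvPolynomial V k) s S.1 *
    (xm k ((insert s S.1).biUnion E \ S.1.biUnion E) * extz f (insert s S.1)) := by
  simp [tD]

/-- embedding into the constant-coefficient complex -/
noncomputable def tJ (E : Fin n → Finset V) {i : ℕ} (f : Idx n i →₀ MvPolynomial V k)
    (T : Finset (Fin n)) : MvPolynomial V k := xm k (T.biUnion E) * extz f T

lemma tJ_inj (E : Fin n → Finset V) {i : ℕ} (f g : Idx n i →₀ MvPolynomial V k)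
    (h : ∀ T, tJ E f T = tJ E g T) : f = g := by
  ext1 S
  have := mul_left_cancel₀ (xm_ne_zero _) (h S.1)
  simpa [extz, S.2] using this

lemma tJ_surj (E : Fin n → Finset V) (i : ℕ) (g : Finset (Fin n) → MvPolynomial V k)
    (hdiv : ∀ T, xm k (T.biUnion E) ∣ g T) (hsupp : ∀ T, T.card ≠ i → g T = 0) :
    ∃ f : Idx n i →₀ MvPolynomial V k, ∀ T, tJ E f T = g T := by
  choose q hq using hdiv
  refine ⟨Finsupp.equivFunOnFinite.symm fun S => q S.1, fun T => ?_⟩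
  unfold tJ extz
  split_ifs with h
  · simp [hq T]
  · rw [hsupp T h, mul_zero]

lemma xm_mul_sdiff {W W' : Finset V} (h : W ⊆ W') : xm k W * xm k (W' \ W) = xm k W' := by
  unfold xm
  rw [mul_comm]
  exact Finset.prod_sdiff h

lemma tJ_tD (E : Fin n → Finset V) (i : ℕ) (f : Idx n (i + 1) →₀ MvPolynomial V k)
    (S : Finset (Fin n)) : tJ E (tD k E i f) S = bd (tJ E f) S := by
  by_cases h : S.card = i
  · have h1 : extz (tD k E i f) S = tD k E i f ⟨S, h⟩ := by simp [extz, h]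
    unfold tJ bd
    rw [h1, tD_apply, Finset.mul_sum]
    refine Finset.sum_congr rfl fun s _ => ?_
    have hsub : S.biUnion E ⊆ (insert s S).biUnion E :=
      Finset.biUnion_subset_biUnion_of_subset_left _ (Finset.subset_insert _ _)
    beta_reduce
    rw [← xm_mul_sdiff (k := k) hsub]
    ring
  · have h1 : extz (tD k E i f) S = 0 := by simp [extz, h]
    unfold tJ bd
    rw [h1, mul_zero]
    symm
    refine Finset.sum_eq_zero fun s hs => ?_
    have : (insert s S).card ≠ i + 1 := by
      rw [Finset.card_insert_of_notMem (by simpa using hs)]; omega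
    simp [extz, this]

lemma tJ_dvd (E : Fin n → Finset V) {i : ℕ} (f : Idx n i →₀ MvPolynomial V k) (T) :
    xm k (T.biUnion E) ∣ tJ E f T := Dvd.intro _ rfl

lemma tJ_supp (E : Fin n → Finset V) {i : ℕ} (f : Idx n i →₀ MvPolynomial V k) (T)
    (hT : T.card ≠ i) : tJ E f T = 0 := by simp [tJ, extz, hT]

lemma tD_exact (E : Fin n → Finset V) (i : ℕ) :
    LinearMap.ker (tD k E i) = LinearMap.range (tD k E (i + 1)) := by
  ext f
  rw [LinearMap.mem_ker]
  constructor
  · intro hf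
    obtain ⟨g', h1, h2, h3⟩ := exists_bd E (tJ E f) (tJ_dvd E f) (i + 1) (by omega) (tJ_supp E f)
      (by intro S; rw [← tJ_tD, hf]; simp [tJ, extz])
    obtain ⟨q, hq⟩ := tJ_surj E _ g' h2 h3
    refine ⟨q, tJ_inj E _ _ fun T => ?_⟩
    rw [tJ_tD, ← h1]
    congr 1
    funext S; exact hq S
  · rintro ⟨q, rfl⟩
    apply tJ_inj E
    intro T
    rw [tJ_tD]
    have : tJ E (tD k E (i + 1) q) = bd (tJ E q) := funext fun S => tJ_tD E _ q S
    rw [this, bd_bd]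
    simp [tJ, extz]

lemma tD_minimal (E : Fin n → Finset V) (hfree : ∀ i, ∃ v ∈ E i, ∀ i', v ∈ E i' → i' = i)
    (i : ℕ) (x) (p) : constantCoeff (tD k E i x p) = 0 := by
  rw [tD_apply, map_sum]
  refine Finset.sum_eq_zero fun s hs => ?_
  obtain ⟨v, hv, hv'⟩ := hfree s
  have hm : v ∈ (insert s p.1).biUnion E \ p.1.biUnion E := by
    simp only [Finset.mem_sdiff, Finset.mem_biUnion, Finset.mem_insert, not_exists, not_and]
    refine ⟨⟨s, Or.inl rfl, hv⟩, fun t ht hvt => ?_⟩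
    rw [hv' t hvt] at ht
    simp [ht] at hs
  have : constantCoeff (xm k ((insert s p.1).biUnion E \ p.1.biUnion E)) = 0 := by
    unfold xm
    rw [map_prod]
    exact Finset.prod_eq_zero hm (by simp)
  rw [map_mul, map_mul, this]; ring

lemma tD_graded (E : Fin n → Finset V) (i : ℕ) :
    GrMap (fun S : Idx n (i + 1) => (S.1.biUnion E).card) (fun S : Idx n i => (S.1.biUnion E).card)
      (tD k E i) := by
  intro T S w h
  rw [tD_apply, coeff_sum] at h
  obtain ⟨s, hs, h⟩ := Finset.exists_ne_zero_of_sum_ne_zero h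
  rw [coeff_sg_mul] at h
  have h := right_ne_zero_of_mul h
  have hc : (insert s S.1).card = i + 1 := by
    rw [Finset.card_insert_of_notMem (by simpa using hs), S.2]
  have hT : T = ⟨insert s S.1, hc⟩ := by
    by_contra hne
    apply h
    have : extz (Finsupp.single T (1 : MvPolynomial V k)) (insert s S.1) = 0 := by
      unfold extz
      rw [dif_pos hc, Finsupp.single_apply, if_neg hne]
    rw [this, mul_zero, coeff_zero]
  have h1 : extz (Finsupp.single T (1 : MvPolynomial V k)) (insert s S.1) = 1 := by
    unfold extz
    rw [dif_pos hc, Finsupp.single_apply, if_pos hT]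
  rw [h1, mul_one, xm_eq, coeff_monomial] at h
  have hw : ex ((insert s S.1).biUnion E \ S.1.biUnion E) = w := by
    by_contra hne
    rw [if_neg hne] at h
    exact h rfl
  subst hT
  rw [← hw, ex_degree]
  exact Finset.card_sdiff_add_card_eq_card
    (Finset.biUnion_subset_biUnion_of_subset_left _ (Finset.subset_insert _ _))

/-- The Taylor resolution. -/
noncomputable def taylor [Fintype V] (E : Fin n → Finset V)
    (hfree : ∀ i, ∃ v ∈ E i, ∀ i', v ∈ E i' → i' = i) : GRes k V (edgeIdeal k E) where
  ι := Idx n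
  deg i S := (S.1.biUnion E).card
  d := tD k E
  exact_succ := tD_exact E
  minimal := tD_minimal E hfree
  graded := tD_graded E
  p0 := ⟨∅, rfl⟩
  uniq p := Subtype.ext (Finset.card_eq_zero.1 p.2)
  deg0 := by simp
  range_zero f := by
    have key : ∀ q, tD k E 0 q ⟨∅, rfl⟩ = ∑ s, (extz q {s}) * ∏ v ∈ E s, X v := by
      intro q
      rw [tD_apply]
      simp only [Finset.compl_empty]
      refine Finset.sum_congr rfl fun s _ => ?_
      simp [sg, xm, mul_comm]
    unfold edgeIdeal
    rw [Ideal.mem_span_range_iff_exists_fun]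
    constructor
    · rintro ⟨q, rfl⟩
      exact ⟨fun s => extz q {s}, (key q).symm⟩
    · rintro ⟨c, hc⟩
      refine ⟨Finsupp.equivFunOnFinite.symm fun S => ∑ s ∈ S.1, c s, ?_⟩
      ext1 S
      have hS : S = ⟨∅, rfl⟩ := Subtype.ext (Finset.card_eq_zero.1 S.2)
      rw [hS, key, ← hc]
      refine Finset.sum_congr rfl fun s _ => ?_
      simp [extz]

end taylor

section final
variable {k V : Type} [Field k] [DecidableEq V] [Fintype V] {n : ℕ}

lemma min_uniq {I : Ideal (MvPolynomial V k)} (F : MinimalGradedFreeResolution k V I) :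
    ∀ p : Σ j : ℕ, Fin (F.β 0 j), p = ⟨0, ⟨0, by rw [F.β_zero]; simp⟩⟩ := by
  rintro ⟨j, t⟩
  have ht : t.1 < if j = 0 then 1 else 0 := lt_of_lt_of_eq t.2 (F.β_zero j)
  by_cases hj : j = 0
  · subst hj
    rw [if_pos rfl] at ht
    congr 1
    apply Fin.ext
    change t.1 = 0
    omega
  · rw [if_neg hj] at ht
    omega

/-- the given resolution, in the general form -/
noncomputable def ofMin {I : Ideal (MvPolynomial V k)} (F : MinimalGradedFreeResolution k V I) :
    GRes k V I where
  ι i := Σ j : ℕ, Fin (F.β i j)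
  deg i p := p.1
  d := F.d
  exact_succ := F.exact_succ
  minimal := F.minimal
  graded := by
    rintro i ⟨j, t⟩ p w h
    obtain ⟨h1, h2⟩ := F.graded i j t p
    have h3 := h1 h
    rcases h2 with h2 | h2
    · have h4 : w.degree = j - p.1 := by
        rw [← h3, Finsupp.degree_eq_weight_one]; rfl
      simp only
      omega
    · rw [h2] at h; simp at h
  p0 := ⟨0, ⟨0, by rw [F.β_zero]; simp⟩⟩
  uniq := min_uniq F
  deg0 := rfl
  range_zero := by
    intro f
    have hu := min_uniq F
    generalize_proofs hp at hu ⊢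
    set p0 : Σ j : ℕ, Fin (F.β 0 j) := ⟨0, ⟨0, hp⟩⟩ with hp0
    have ha : ∀ f, F.aug f = f p0 • F.aug (Finsupp.single p0 1) := by
      intro f
      rw [← map_smul]
      congr 1
      ext1 p
      rw [hu p]; simp
    have hs : ∀ a r : MvPolynomial V k,
        a • (Ideal.Quotient.mk I r) = Ideal.Quotient.mk I (a * r) := fun _ _ => rfl
    rw [← F.exact_zero, LinearMap.mem_ker, ha]
    obtain ⟨g, hg⟩ := F.aug_surjective 1
    rw [ha] at hg
    constructor
    · intro h
      rw [← Ideal.Quotient.eq_zero_iff_mem]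
      have h1 : f p0 • (1 : MvPolynomial V k ⧸ I) = 0 := by
        rw [← hg, smul_comm, h, smul_zero]
      rw [← map_one (Ideal.Quotient.mk I), hs, mul_one] at h1
      exact h1
    · intro h
      obtain ⟨y, hy⟩ := Ideal.Quotient.mk_surjective (F.aug (Finsupp.single p0 1))
      rw [← hy, hs, Ideal.Quotient.eq_zero_iff_mem]
      exact I.mul_mem_right _ h

lemma card_ofMin {I : Ideal (MvPolynomial V k)} (F : MinimalGradedFreeResolution k V I)
    (i j : ℕ) : Finite {e : (ofMin F).ι i // (ofMin F).deg i e = j} ∧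
      Nat.card {e : (ofMin F).ι i // (ofMin F).deg i e = j} = F.β i j := by
  have e : Fin (F.β i j) ≃ {e : (ofMin F).ι i // (ofMin F).deg i e = j} :=
    { toFun := fun t => ⟨⟨j, t⟩, rfl⟩
      invFun := fun e => Fin.cast (congrArg (F.β i) e.2) e.1.2
      left_inv := fun t => rfl
      right_inv := by
        rintro ⟨⟨j', t⟩, h⟩
        change j' = j at h
        subst h
        rfl }
  exact ⟨Finite.of_equiv _ e, by rw [← Nat.card_congr e, Nat.card_fin]⟩

lemma beta_eq (E : Fin n → Finset V) (hfree : ∀ i, ∃ v ∈ E i, ∀ i', v ∈ E i' → i' = i)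
    (F : MinimalGradedFreeResolution k V (edgeIdeal k E)) (i j : ℕ) :
    F.β i j = Nat.card {S : Idx n i // (S.1.biUnion E).card = j} := by
  obtain ⟨h1, h2⟩ := card_ofMin F i j
  have h3 : Finite {S : (taylor (k := k) E hfree).ι i // (taylor (k := k) E hfree).deg i S = j} :=
    inferInstanceAs (Finite {S : Idx n i // (S.1.biUnion E).card = j})
  rw [← h2]
  exact le_antisymm (card_le (ofMin F) (taylor E hfree) i j) (card_le (taylor E hfree) (ofMin F) i j)

lemma card_union (d α : ℕ) (E : Fin n → Finset V) (A : Finset V)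
    (huniform : ∀ i, (E i).card = d) (hA : A.card = α) (hAsub : ∀ i, A ⊆ E i)
    (hAint : ∀ i j, i ≠ j → E i ∩ E j = A) (S : Finset (Fin n)) :
    (S.biUnion E).card = S.card * d - α * (S.card - 1) := by
  rcases S.eq_empty_or_nonempty with rfl | hS
  · simp
  have h1 : S.biUnion E = A ∪ S.biUnion (fun s => E s \ A) := by
    ext v
    simp only [Finset.mem_biUnion, Finset.mem_union, Finset.mem_sdiff]
    constructor
    · rintro ⟨s, hs, hv⟩
      by_cases h : v ∈ A
      · exact Or.inl h
      · exact Or.inr ⟨s, hs, hv, h⟩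
    · rintro (h | ⟨s, hs, hv, -⟩)
      · obtain ⟨s, hs⟩ := hS
        exact ⟨s, hs, hAsub s h⟩
      · exact ⟨s, hs, hv⟩
  have h2 : Disjoint A (S.biUnion (fun s => E s \ A)) := by
    rw [Finset.disjoint_biUnion_right]
    intro s _
    exact Finset.disjoint_sdiff
  have h3 : (S : Set (Fin n)).PairwiseDisjoint (fun s => E s \ A) := by
    intro s _ t _ hst
    rw [Function.onFun, Finset.disjoint_left]
    intro v hv hv'
    rw [Finset.mem_sdiff] at hv hv'
    exact hv.2 (hAint s t hst ▸ Finset.mem_inter.2 ⟨hv.1, hv'.1⟩)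
  rw [h1, Finset.card_union_of_disjoint h2, Finset.card_biUnion h3, hA]
  have h4 : ∀ s ∈ S, (E s \ A).card = d - α := by
    intro s _
    rw [Finset.card_sdiff_of_subset (hAsub s), huniform, hA]
  rw [Finset.sum_congr rfl h4, Finset.sum_const, smul_eq_mul]
  obtain ⟨s, hs⟩ := hS
  have h5 : α ≤ d := by
    rw [← hA, ← huniform s]; exact Finset.card_le_card (hAsub s)
  obtain ⟨m, hm⟩ : ∃ m, S.card = m + 1 :=
    Nat.exists_eq_succ_of_ne_zero (Finset.card_ne_zero_of_mem hs)
  obtain ⟨e, rfl⟩ := Nat.exists_eq_add_of_le h5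
  rw [hm]
  simp only [Nat.add_sub_cancel_left, Nat.add_sub_cancel]
  symm
  apply Nat.sub_eq_of_eq_add
  ring

end final
end StarBetti

/-- Let `H` be a `d`-uniform hypergraph with (distinct) edges
`E 0, …, E (n-1)` such that for some fixed `α`, any two distinct edges intersect in the
common intersection `A` of all the edges, which has `α` vertices (so
`|E_i ∩ E_j| = |⋂_l E_l| = α` for all `i ≠ j`), and each edge has a free vertex.  Then
`β_{i,j}(R ⧸ I(H)) ≠ 0` only if `j = i·d - α·(i-1)`, and
`β_{i, i·d - α·(i-1)}(R ⧸ I(H)) = C(n, i)`. -/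
theorem gradedBetti_star (k V : Type) [Field k] [Fintype V] [DecidableEq V]
    (n d α : ℕ) (E : Fin n → Finset V) (A : Finset V)
    (hinj : Function.Injective E)
    (huniform : ∀ i, (E i).card = d)
    (hcover : ∀ v : V, ∃ i, v ∈ E i)
    (hA : A.card = α)
    (hAsub : ∀ i, A ⊆ E i)
    (hAint : ∀ i j, i ≠ j → E i ∩ E j = A)
    (hfree : ∀ i, ∃ v ∈ E i, ∀ i', v ∈ E i' → i' = i)
    (F : MinimalGradedFreeResolution k V (edgeIdeal k E)) :
    (∀ i j, F.β i j ≠ 0 → j = i * d - α * (i - 1)) ∧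
      (∀ i, F.β i (i * d - α * (i - 1)) = n.choose i) := by
  have key := fun i j => StarBetti.beta_eq E hfree F i j
  have hcard := StarBetti.card_union d α E A huniform hA hAsub hAint
  constructor
  · intro i j h
    rw [key] at h
    obtain ⟨⟨⟨S, hS⟩, hj⟩⟩ := (Nat.card_ne_zero.1 h).1
    simp only at hj
    rw [← hj, hcard, hS]
  · intro i
    rw [key]
    have e : {S : StarBetti.Idx n i // (S.1.biUnion E).card = i * d - α * (i - 1)} ≃
        StarBetti.Idx n i :=
      Equiv.subtypeUnivEquiv (fun S => by rw [hcard, S.2])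
    rw [Nat.card_congr e, Nat.card_eq_fintype_card, Fintype.card_finset_len, Fintype.card_fin]
end

section
/- If H is a chordal d-uniform hypergraph, then the Stanley–Reisner ideal I_{Delta(H)} of the clique complex of H has linear quotients; equivalently, the Alexander dual complex of Delta(H) is pure shellable. -/
open MvPolynomial

/-- The squarefree monomial `x^F = ∏_{v ∈ F} x_v`. -/
noncomputable def sqMonomial (k : Type) {V : Type} [Field k] [DecidableEq V]
    (F : Finset V) : MvPolynomial V k :=
  ∏ v ∈ F, X v

/-- A (squarefree) monomial ideal `I` has *linear quotients* if its minimal monomial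
generators can be ordered `x^{m 0}, …, x^{m (t-1)}` so that for each `s` the colon ideal
`(x^{m 0}, …, x^{m (s-1)}) : x^{m s}` is generated by a set of variables. -/
def HasLinearQuotients (k : Type) {V : Type} [Field k] [Fintype V] [DecidableEq V]
    (I : Ideal (MvPolynomial V k)) : Prop :=
  ∃ (t : ℕ) (m : Fin t → Finset V),
    (∀ a b : Fin t, m a ⊆ m b → a = b) ∧
    I = Ideal.span (Set.range fun s => sqMonomial k (m s)) ∧
    ∀ s : Fin t, ∃ S : Set V,
      Submodule.colon
          (Ideal.span {p | ∃ s' : Fin t, s' < s ∧ p = sqMonomial k (m s')})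
          (Ideal.span {sqMonomial k (m s)}) =
        Ideal.span ((fun v => (X v : MvPolynomial V k)) '' S)

/-- Chordal `d`-uniform hypergraphs (on subsets of an ambient vertex type `V`), given by
a vertex set `X` together with an edge set `E`, built inductively: every `d`-complete
hypergraph `K_n^d` is chordal, and attaching a `d`-complete hypergraph `K_i^d` (vertex
set `Y`) to a chordal hypergraph along a common `K_j^d` (vertex set `J = Y ∩ X`,
`0 ≤ j < i`) again yields a chordal hypergraph. -/
inductive ChordalHypergraph {V : Type} [DecidableEq V] (d : ℕ) :
    Finset V → Finset (Finset V) → Prop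
  | complete (X : Finset V) : ChordalHypergraph d X (X.powersetCard d)
  | attach (X : Finset V) (E : Finset (Finset V)) (Y J : Finset V) :
      ChordalHypergraph d X E → Y ∩ X = J → J ⊂ Y → J.powersetCard d ⊆ E →
      ChordalHypergraph d (X ∪ Y) (E ∪ Y.powersetCard d)

/-- The Stanley–Reisner ideal of the clique complex `Δ(H)` of the `d`-uniform hypergraph
with vertex set `X` and edge set `E`: it is generated by the squarefree monomials `x^F`
over the nonfaces `F` of `Δ(H)`, where `F` is a face of `Δ(H)` iff `F ⊆ X` and every
`d`-subset of `F` is an edge. -/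
noncomputable def cliqueComplexIdeal (k : Type) {V : Type} [Field k] [Fintype V]
    [DecidableEq V] (d : ℕ) (X : Finset V) (E : Finset (Finset V)) :
    Ideal (MvPolynomial V k) :=
  Ideal.span {p | ∃ F : Finset V, ¬(F ⊆ X ∧ F.powersetCard d ⊆ E) ∧ p = sqMonomial k F}

theorem exists_colexRank (V : Type) [Fintype V] [DecidableEq V] :
    ∃ f : Finset V → ℕ, Function.Injective f ∧ ∀ F F' : Finset V, f F' < f F →
      ∃ v ∈ F', v ∉ F ∧ ∀ w ∈ F, w ∉ F' → f (insert v (F.erase w)) < f F := by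
  let e : V ↪ ℕ := (Fintype.equivFin V).toEmbedding.trans Fin.valEmbedding
  have hlt : ∀ F F' : Finset V,
      (∑ i ∈ F'ᶜ.map e, 2 ^ i < ∑ i ∈ Fᶜ.map e, 2 ^ i) ↔
        ∃ v ∈ F', v ∉ F ∧ ∀ w ∈ F, w ∉ F' → e w < e v := by
    intro F F'
    rw [Finset.geomSum_lt_geomSum_iff_toColex_lt_toColex le_rfl,
      Finset.Colex.toColex_lt_toColex_iff_exists_forall_lt]
    constructor
    · rintro ⟨a, ha, ha', h⟩
      obtain ⟨v, hv, rfl⟩ := Finset.mem_map.1 ha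
      simp only [Finset.mem_map', Finset.mem_compl, not_not] at hv ha'
      refine ⟨v, ha', hv, fun w hw hw' => h (e w) ?_ ?_⟩
      · simpa only [Finset.mem_map', Finset.mem_compl] using hw'
      · simpa only [Finset.mem_map', Finset.mem_compl, not_not] using hw
    · rintro ⟨v, hv', hv, h⟩
      refine ⟨e v, ?_, ?_, ?_⟩
      · simpa only [Finset.mem_map', Finset.mem_compl] using hv
      · simpa only [Finset.mem_map', Finset.mem_compl, not_not] using hv'
      · intro b hb hb'
        obtain ⟨w, hw, rfl⟩ := Finset.mem_map.1 hb
        simp only [Finset.mem_map', Finset.mem_compl, not_not] at hw hb'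
        exact h w hb' hw
  refine ⟨fun F => ∑ i ∈ Fᶜ.map e, 2 ^ i, ?_, ?_⟩
  · intro F F' h
    have := Finset.geomSum_injective (n := 2) le_rfl h
    exact compl_injective (Finset.map_injective e this)
  · intro F F' h
    obtain ⟨v, hv', hv, h⟩ := (hlt F F').1 h
    refine ⟨v, hv', hv, fun w hw hw' => (hlt _ _).2 ⟨v, by simp, hv, ?_⟩⟩
    intro u hu hu'
    have : u = w := by
      by_contra hne
      exact hu' (by simp [hne, hu])
    subst this
    exact h _ hw hw'

/-- Basis exchange for the matroid of `d`-sets meeting two disjoint sets `Z` and `W`. -/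
theorem exchange_two {V : Type} [DecidableEq V] (Z W F F' : Finset V)
    (hc : F.card = F'.card) (hZ : (F ∩ Z).Nonempty) (hW : (F ∩ W).Nonempty)
    (hZ' : (F' ∩ Z).Nonempty) (hW' : (F' ∩ W).Nonempty) (hdis : Disjoint Z W)
    (v : V) (hv : v ∈ F') (hvF : v ∉ F) :
    ∃ w ∈ F, w ∉ F' ∧ (insert v (F.erase w) ∩ Z).Nonempty ∧
      (insert v (F.erase w) ∩ W).Nonempty := by
  have hcard : (F \ F').card = (F' \ F).card := Finset.card_sdiff_comm hc
  have hd : ∀ x, x ∈ Z → x ∉ W := fun x hx hx' => (Finset.disjoint_left.1 hdis) hx hx'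
  by_contra hcon
  push Not at hcon
  have key : ∀ w ∈ F, w ∉ F' →
      (v ∉ Z ∧ w ∈ Z ∧ ∀ x ∈ F, x ∈ Z → x = w) ∨ (v ∉ W ∧ w ∈ W ∧ ∀ x ∈ F, x ∈ W → x = w) := by
    intro w hw hw'
    have h := hcon w hw hw'
    obtain ⟨z, hz⟩ := hZ
    obtain ⟨y, hy⟩ := hW
    simp only [Finset.mem_inter] at hz hy
    by_cases hne : (insert v (F.erase w) ∩ Z).Nonempty
    · right
      have h2 := h hne
      have h3 : ∀ x, x ∈ insert v (F.erase w) → x ∉ W := by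
        intro x hx hxW
        have : x ∈ insert v (F.erase w) ∩ W := Finset.mem_inter.2 ⟨hx, hxW⟩
        simp [h2] at this
      have h4 : ∀ x ∈ F, x ∈ W → x = w := by
        intro x hx hxW
        by_contra hxw
        exact h3 x (by simp [hxw, hx]) hxW
      exact ⟨h3 v (by simp), h4 y hy.1 hy.2 ▸ hy.2, h4⟩
    · left
      have h3 : ∀ x, x ∈ insert v (F.erase w) → x ∉ Z := by
        intro x hx hxW
        exact hne ⟨x, Finset.mem_inter.2 ⟨hx, hxW⟩⟩
      have h4 : ∀ x ∈ F, x ∈ Z → x = w := by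
        intro x hx hxW
        by_contra hxw
        exact h3 x (by simp [hxw, hx]) hxW
      exact ⟨h3 v (by simp), h4 z hz.1 hz.2 ▸ hz.2, h4⟩
  have hex : ∀ w ∈ F \ F', ∃ u ∈ (F' \ F).erase v,
      (w ∈ Z ∧ u ∈ Z ∧ ∀ x ∈ F, x ∈ Z → x = w) ∨ (w ∈ W ∧ u ∈ W ∧ ∀ x ∈ F, x ∈ W → x = w) := by
    intro w hw
    obtain ⟨hw, hw'⟩ := Finset.mem_sdiff.1 hw
    rcases key w hw hw' with ⟨h1, h2, h3⟩ | ⟨h1, h2, h3⟩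
    · obtain ⟨u, hu⟩ := hZ'
      simp only [Finset.mem_inter] at hu
      refine ⟨u, ?_, Or.inl ⟨h2, hu.2, h3⟩⟩
      simp only [Finset.mem_erase, Finset.mem_sdiff]
      exact ⟨fun h => h1 (h ▸ hu.2), hu.1, fun h => hw' (h3 u h hu.2 ▸ hu.1)⟩
    · obtain ⟨u, hu⟩ := hW'
      simp only [Finset.mem_inter] at hu
      refine ⟨u, ?_, Or.inr ⟨h2, hu.2, h3⟩⟩
      simp only [Finset.mem_erase, Finset.mem_sdiff]
      exact ⟨fun h => h1 (h ▸ hu.2), hu.1, fun h => hw' (h3 u h hu.2 ▸ hu.1)⟩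
  choose! g hg1 hg2 using hex
  have hle : (F \ F').card ≤ ((F' \ F).erase v).card := by
    apply Finset.card_le_card_of_injOn g hg1
    intro a ha b hb hab
    have ha2 := hg2 a ha
    have hb2 := hg2 b hb
    have haF := (Finset.mem_sdiff.1 ha).1
    rw [← hab] at hb2
    rcases ha2 with ⟨h1, h2, h3⟩ | ⟨h1, h2, h3⟩ <;> rcases hb2 with ⟨k1, k2, k3⟩ | ⟨k1, k2, k3⟩
    · exact k3 a haF h1
    · exact absurd k2 (hd _ h2)
    · exact absurd h2 (hd _ k2)
    · exact k3 a haF h1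
  have hv2 : v ∈ F' \ F := Finset.mem_sdiff.2 ⟨hv, hvF⟩
  rw [Finset.card_erase_of_mem hv2, hcard] at hle
  have := Finset.card_pos.2 ⟨v, hv2⟩
  omega

/-- Combinatorial linear quotients for a family of sets, the order given by a rank function. -/
def RankLQ {V : Type} [DecidableEq V] (N : Finset (Finset V)) : Prop :=
  ∃ f : Finset V → ℕ, Set.InjOn f N ∧ ∀ F ∈ N, ∀ F' ∈ N, f F' < f F →
    ∃ v ∈ F', v ∉ F ∧ ∃ F'' ∈ N, f F'' < f F ∧ F'' ⊆ insert v F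

theorem chordal_rankLQ {V : Type} [Fintype V] [DecidableEq V] (d : ℕ) (X : Finset V)
    (E : Finset (Finset V)) (h : ChordalHypergraph d X E) :
    E ⊆ X.powersetCard d ∧ RankLQ (X.powersetCard d \ E) := by
  induction h with
  | complete X => exact ⟨subset_rfl, fun _ => 0, by simp, by simp⟩
  | attach X E Y J hch hJ hJY hJE ih =>
    obtain ⟨hE, f, hfi, hf⟩ := ih
    refine ⟨Finset.union_subset
      (hE.trans (Finset.powersetCard_mono Finset.subset_union_left))
      (Finset.powersetCard_mono Finset.subset_union_right), ?_⟩
    obtain ⟨c, hci, hc⟩ := exists_colexRank V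
    -- membership, old and new
    have hold : ∀ F, F ⊆ X → (F ∈ (X ∪ Y).powersetCard d \ (E ∪ Y.powersetCard d) ↔
        F ∈ X.powersetCard d \ E) := by
      intro F hF
      simp only [Finset.mem_sdiff, Finset.mem_powersetCard, Finset.mem_union]
      constructor
      · rintro ⟨⟨_, h1⟩, h2⟩
        exact ⟨⟨hF, h1⟩, fun h => h2 (Or.inl h)⟩
      · rintro ⟨⟨_, h1⟩, h2⟩
        refine ⟨⟨hF.trans Finset.subset_union_left, h1⟩, ?_⟩
        rintro (h | ⟨h, _⟩)
        · exact h2 h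
        · exact h2 (hJE (Finset.mem_powersetCard.2 ⟨hJ ▸ Finset.subset_inter h hF, h1⟩))
    have hnew : ∀ F, ¬ F ⊆ X → (F ∈ (X ∪ Y).powersetCard d \ (E ∪ Y.powersetCard d) ↔
        (F ⊆ X ∪ Y ∧ F.card = d ∧ (F ∩ (Y \ X)).Nonempty ∧ (F ∩ (X \ Y)).Nonempty)) := by
      intro F hF
      simp only [Finset.mem_sdiff, Finset.mem_powersetCard, Finset.mem_union]
      constructor
      · rintro ⟨⟨h0, h1⟩, h2⟩
        have h3 : ¬ F ⊆ Y := fun h => h2 (Or.inr ⟨h, h1⟩)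
        obtain ⟨a, ha, ha'⟩ := Finset.not_subset.1 hF
        obtain ⟨b, hb, hb'⟩ := Finset.not_subset.1 h3
        have := h0 ha
        have := h0 hb
        refine ⟨h0, h1, ⟨a, ?_⟩, ⟨b, ?_⟩⟩ <;> simp_all
      · rintro ⟨h0, h1, h2, ⟨b, hb⟩⟩
        refine ⟨⟨h0, h1⟩, ?_⟩
        rintro (h | ⟨h, _⟩)
        · exact hF (Finset.mem_powersetCard.1 (hE h)).1
        · simp only [Finset.mem_inter, Finset.mem_sdiff] at hb
          exact hb.2.2 (h hb.1)
    have hnX : ∀ F : Finset V, (F ∩ (Y \ X)).Nonempty → ¬ F ⊆ X := by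
      rintro F ⟨a, ha⟩ h
      simp only [Finset.mem_inter, Finset.mem_sdiff] at ha
      exact ha.2.2 (h ha.1)
    let B : ℕ := (Finset.univ.sup c) + 1
    have hB : ∀ F, c F < B := fun F => Nat.lt_succ_of_le (Finset.le_sup (Finset.mem_univ F))
    let g : Finset V → ℕ := fun F => if F ⊆ X then B + f F else c F
    have gold : ∀ F, F ⊆ X → g F = B + f F := fun F h => if_pos h
    have gnew : ∀ F, ¬ F ⊆ X → g F = c F := fun F h => if_neg h
    refine ⟨g, ?_, ?_⟩
    · intro F hF F' hF' hg
      have hF := Finset.mem_coe.1 hF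
      have hF' := Finset.mem_coe.1 hF'
      have := hB F
      have := hB F'
      by_cases h : F ⊆ X <;> by_cases h' : F' ⊆ X
      · rw [gold _ h, gold _ h'] at hg
        exact hfi ((hold F h).1 hF) ((hold F' h').1 hF') (by omega)
      · rw [gold _ h, gnew _ h'] at hg; omega
      · rw [gnew _ h, gold _ h'] at hg; omega
      · rw [gnew _ h, gnew _ h'] at hg
        exact hci hg
    · intro F hF F' hF' hg
      have hBF := hB F
      have hBF' := hB F'
      by_cases h : F ⊆ X <;> by_cases h' : F' ⊆ X
      · rw [gold _ h, gold _ h'] at hg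
        obtain ⟨v, hv', hv, F'', hF'', hlt, hsub⟩ :=
          hf F ((hold F h).1 hF) F' ((hold F' h').1 hF') (by omega)
        have h'' : F'' ⊆ X := (Finset.mem_powersetCard.1 (Finset.mem_sdiff.1 hF'').1).1
        refine ⟨v, hv', hv, F'', (hold F'' h'').2 hF'', ?_, hsub⟩
        rw [gold _ h, gold _ h'']; omega
      · -- old versus new
        obtain ⟨h0', h1', ⟨z, hz⟩, ⟨y, hy⟩⟩ := (hnew F' h').1 hF'
        simp only [Finset.mem_inter, Finset.mem_sdiff] at hz hy
        have hF2 := hF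
        simp only [Finset.mem_sdiff, Finset.mem_powersetCard, Finset.mem_union, not_or] at hF2
        obtain ⟨⟨-, h1⟩, -, h3⟩ := hF2
        obtain ⟨b, hb, hbY⟩ := Finset.not_subset.1 (fun hs => h3 ⟨hs, h1⟩)
        have hcard : 1 < F.card := by
          rw [h1, ← h1', Finset.one_lt_card]
          exact ⟨z, hz.1, y, hy.1, fun e => hz.2.2 (e ▸ hy.2.1)⟩
        obtain ⟨w, hw, hwb⟩ := Finset.exists_mem_ne hcard b
        have hzF : z ∉ F := fun hh => hz.2.2 (h hh)
        have hne : (insert z (F.erase w) ∩ (Y \ X)).Nonempty := ⟨z, by simp [hz.2]⟩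
        refine ⟨z, hz.1, hzF, insert z (F.erase w), ?_, ?_, ?_⟩
        · refine (hnew _ (hnX _ hne)).2 ⟨?_, ?_, hne, ⟨b, ?_⟩⟩
          · refine Finset.insert_subset (h0' hz.1) ?_
            exact (Finset.erase_subset _ _).trans (h.trans Finset.subset_union_left)
          · rw [Finset.card_insert_of_notMem (fun hh => hzF (Finset.mem_of_mem_erase hh)),
              Finset.card_erase_of_mem hw]
            omega
          · simp [hb, hbY, h hb, hwb.symm]
        · rw [gold _ h, gnew _ (hnX _ hne)]
          have := hB (insert z (F.erase w))
          omega
        · exact Finset.insert_subset_insert _ (Finset.erase_subset _ _)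
      · rw [gnew _ h, gold _ h'] at hg; omega
      · rw [gnew _ h, gnew _ h'] at hg
        obtain ⟨h0, h1, h2, h3⟩ := (hnew F h).1 hF
        obtain ⟨h0', h1', h2', h3'⟩ := (hnew F' h').1 hF'
        obtain ⟨v, hv', hv, hlt⟩ := hc F F' hg
        obtain ⟨w, hw, hw', hZ, hW⟩ := exchange_two (Y \ X) (X \ Y) F F' (h1.trans h1'.symm)
          h2 h3 h2' h3' disjoint_sdiff_sdiff v hv' hv
        refine ⟨v, hv', hv, insert v (F.erase w), ?_, ?_, ?_⟩
        · refine (hnew _ (hnX _ hZ)).2 ⟨?_, ?_, hZ, hW⟩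
          · exact Finset.insert_subset (h0' hv') ((Finset.erase_subset _ _).trans h0)
          · rw [Finset.card_insert_of_notMem (fun hh => hv (Finset.mem_of_mem_erase hh)),
              Finset.card_erase_of_mem hw]
            have := Finset.card_pos.2 ⟨w, hw⟩
            omega
        · rw [gnew _ h, gnew _ (hnX _ hZ)]
          exact hlt w hw hw'
        · exact Finset.insert_subset_insert _ (Finset.erase_subset _ _)

theorem sqMonomial_dvd (k : Type) {V : Type} [Field k] [DecidableEq V] {F G : Finset V}
    (h : F ⊆ G) : sqMonomial k F ∣ sqMonomial k G :=
  Finset.prod_dvd_prod_of_subset _ _ _ h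

/-- Exponent vector of `x^F`. -/
noncomputable def sqExp {V : Type} [DecidableEq V] (F : Finset V) : V →₀ ℕ :=
  ∑ v ∈ F, Finsupp.single v 1

theorem sqExp_apply {V : Type} [DecidableEq V] (F : Finset V) (v : V) :
    sqExp F v = if v ∈ F then 1 else 0 := by
  simp [sqExp, Finsupp.finsetSum_apply, Finsupp.single_apply]

theorem sqMonomial_eq (k : Type) {V : Type} [Field k] [DecidableEq V] (F : Finset V) :
    sqMonomial k F = monomial (sqExp F) (1 : k) := by
  simp [sqMonomial, sqExp, monomial_sum_one, MvPolynomial.X]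

theorem colon_eq_vars (k : Type) {V : Type} [Field k] [DecidableEq V]
    (P : Finset V → Prop) (F : Finset V)
    (hP : ∀ F', P F' → ∃ v ∈ F', v ∉ F ∧ ∃ F'', P F'' ∧ F'' ⊆ insert v F) :
    Submodule.colon (Ideal.span {p | ∃ F', P F' ∧ p = sqMonomial k F'})
        (Ideal.span {sqMonomial k F}) =
      Ideal.span ((fun v => (X v : MvPolynomial V k)) '' {v | v ∉ F ∧ ∃ F'', P F'' ∧ F'' ⊆ insert v F}) := by
  have hset : {p | ∃ F', P F' ∧ p = sqMonomial k F'} =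
      (fun s => monomial s (1 : k)) '' (sqExp '' {F' | P F'}) := by
    ext p
    simp only [Set.mem_ofPred_eq, Set.mem_image, exists_exists_and_eq_and, sqMonomial_eq]
    constructor
    · rintro ⟨a, h, rfl⟩; exact ⟨a, h, rfl⟩
    · rintro ⟨a, h, rfl⟩; exact ⟨a, h, rfl⟩
  apply le_antisymm
  · intro p hp
    have h1 : p * sqMonomial k F ∈ Ideal.span {p | ∃ F', P F' ∧ p = sqMonomial k F'} :=
      Submodule.mem_colon.1 hp _ (Ideal.subset_span rfl)
    rw [hset, mem_ideal_span_monomial_image] at h1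
    refine mem_ideal_span_X_image.2 fun m hm => ?_
    have h2 : m + sqExp F ∈ (p * sqMonomial k F).support := by
      rw [mem_support_iff, sqMonomial_eq, coeff_mul_monomial, mul_one]
      exact mem_support_iff.1 hm
    obtain ⟨_, ⟨F', hF', rfl⟩, hle⟩ := h1 _ h2
    obtain ⟨v, hv, hvF, hex⟩ := hP F' hF'
    refine ⟨v, ⟨hvF, hex⟩, ?_⟩
    have h3 := hle v
    rw [Finsupp.add_apply, sqExp_apply, sqExp_apply, if_pos hv, if_neg hvF] at h3
    omega
  · rw [Ideal.span_le]
    rintro _ ⟨v, ⟨hv, F'', hF'', hsub⟩, rfl⟩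
    refine Submodule.mem_colon.2 fun q hq => ?_
    obtain ⟨r, rfl⟩ := Ideal.mem_span_singleton.1 hq
    have h1 : sqMonomial k (insert v F) = X v * sqMonomial k F := Finset.prod_insert hv
    have h2 : X v * sqMonomial k F ∈ Ideal.span {p | ∃ F', P F' ∧ p = sqMonomial k F'} := by
      rw [← h1]
      exact Ideal.mem_of_dvd _ (sqMonomial_dvd k hsub) (Ideal.subset_span ⟨F'', hF'', rfl⟩)
    have h3 := Ideal.mul_mem_right r _ h2
    rwa [mul_assoc] at h3

/-- If `H` is a chordal `d`-uniform hypergraph (with vertex set the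
whole of `V`), then the Stanley–Reisner ideal `I_{Δ(H)}` of the clique complex of `H`
has linear quotients. -/
theorem chordalHypergraph_linearQuotients (k V : Type) [Field k] [Fintype V]
    [DecidableEq V] (d : ℕ) (X : Finset V) (E : Finset (Finset V))
    (hchordal : ChordalHypergraph d X E) (hX : X = Finset.univ) :
    HasLinearQuotients k (cliqueComplexIdeal k d X E) := by
  subst hX
  obtain ⟨hE, f, hfi, hf⟩ := chordal_rankLQ d _ E hchordal
  set N := (Finset.univ : Finset V).powersetCard d \ E with hN
  have hNm : ∀ F, F ∈ N ↔ F.card = d ∧ F ∉ E := by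
    intro F; simp [hN, Finset.mem_powersetCard]
  -- enumerate `N` along the rank
  let T := N.image f
  let e := T.orderIsoOfFin rfl
  have hch : ∀ i : Fin T.card, ∃ F ∈ N, f F = (e i : ℕ) := fun i =>
    Finset.mem_image.1 (e i).2
  choose m hmN hmf using hch
  have hlt : ∀ a b, a < b ↔ f (m a) < f (m b) := by
    intro a b
    rw [hmf, hmf, Subtype.coe_lt_coe, e.lt_iff_lt]
  have hsurj : ∀ F ∈ N, ∃ i, m i = F := by
    intro F hF
    refine ⟨e.symm ⟨f F, Finset.mem_image_of_mem f hF⟩, hfi (hmN _) hF ?_⟩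
    rw [hmf]; simp
  refine ⟨T.card, m, ?_, ?_, ?_⟩
  · intro a b hab
    have heq : m a = m b := Finset.eq_of_subset_of_card_le hab
      (by rw [((hNm _).1 (hmN a)).1, ((hNm _).1 (hmN b)).1])
    apply e.injective
    apply Subtype.ext
    rw [← hmf, ← hmf, heq]
  · apply le_antisymm
    · refine Ideal.span_le.2 ?_
      rintro _ ⟨F, hF, rfl⟩
      have hF' : ¬ F.powersetCard d ⊆ E := fun h => hF ⟨Finset.subset_univ _, h⟩
      obtain ⟨D, hD, hDE⟩ := Finset.not_subset.1 hF'
      rw [Finset.mem_powersetCard] at hD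
      obtain ⟨i, hi⟩ := hsurj D ((hNm D).2 ⟨hD.2, hDE⟩)
      exact Ideal.mem_of_dvd _ (sqMonomial_dvd k hD.1) (Ideal.subset_span ⟨i, by simp [hi]⟩)
    · refine Ideal.span_le.2 ?_
      rintro _ ⟨i, rfl⟩
      refine Ideal.subset_span ⟨m i, fun h => ?_, rfl⟩
      obtain ⟨h1, h2⟩ := (hNm _).1 (hmN i)
      exact h2 (h.2 (Finset.mem_powersetCard.2 ⟨subset_rfl, h1⟩))
  · intro s
    have hset : {p | ∃ s' : Fin T.card, s' < s ∧ p = sqMonomial k (m s')} =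
        {p | ∃ F', (F' ∈ N ∧ f F' < f (m s)) ∧ p = sqMonomial k F'} := by
      ext p
      constructor
      · rintro ⟨s', h, rfl⟩
        exact ⟨m s', ⟨hmN _, (hlt _ _).1 h⟩, rfl⟩
      · rintro ⟨F', ⟨h, h'⟩, rfl⟩
        obtain ⟨i, rfl⟩ := hsurj F' h
        exact ⟨i, (hlt _ _).2 h', rfl⟩
    rw [hset]
    refine ⟨_, colon_eq_vars k (fun F' => F' ∈ N ∧ f F' < f (m s)) (m s) ?_⟩
    rintro F' ⟨h, h'⟩
    obtain ⟨v, hv, hv', F'', h1, h2, h3⟩ := hf _ (hmN s) F' h h'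
    exact ⟨v, hv, hv', F'', ⟨h1, h2⟩, h3⟩
end
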